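/- arXiv:0810.4867 — 3 statements merged into one kernel-verified Lean document; each statement's English description precedes it below -/
import Mathlib

section
/- Let 𝔾 be a right-angled Artin group and ℍ a directly indecomposable canonical parabolic subgroup of 𝔾. Then the group 𝔾' = ⟨ 𝔾, t | relations of 𝔾, [t, C_𝔾(ℍ)] = 1 ⟩ (the extension of the centraliser C_𝔾(ℍ)) is a right-angled Artin group and is 𝔾-discriminated by 𝔾: for every finite set of nontrivial elements of 𝔾' there exists a 𝔾-homomorphism 𝔾' → 𝔾 mapping each of them to a nontrivial element. -/
/-- The defining relators of the right-angled Artin group on a simple graph `Γ`: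
one commutator relator `[a,b] = a b a⁻¹ b⁻¹` for each edge `{a,b}` of `Γ`. -/
def raagRels {A : Type*} (Γ : SimpleGraph A) : Set (FreeGroup A) :=
  {r | ∃ a b : A, Γ.Adj a b ∧
    r = FreeGroup.of a * FreeGroup.of b * (FreeGroup.of a)⁻¹ * (FreeGroup.of b)⁻¹}

/-- The right-angled Artin group (partially commutative group) `𝔾(Γ)` on a simple
graph `Γ`. -/
abbrev RAAG {A : Type*} (Γ : SimpleGraph A) :=
  PresentedGroup (raagRels Γ)

/-- The canonical generator of `𝔾(Γ)` corresponding to a vertex `a`. -/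
def raagGen {A : Type*} (Γ : SimpleGraph A) (a : A) : RAAG Γ :=
  PresentedGroup.of a

/-- The canonical projection `F(A) → 𝔾(Γ)`. -/
def raagMk {A : Type*} (Γ : SimpleGraph A) : FreeGroup A →* RAAG Γ :=
  PresentedGroup.mk (raagRels Γ)

/-- The length of `g ∈ 𝔾(Γ)`: the minimal length of a word in the generators and their
inverses representing `g` (the length of a geodesic representative of `g`). -/
noncomputable def raagLen {A : Type*} (Γ : SimpleGraph A) (g : RAAG Γ) : ℕ :=
  sInf {m | ∃ l : List (A × Bool), l.length = m ∧ raagMk Γ (FreeGroup.mk l) = g}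

/-- The support `α(g)` of `g ∈ 𝔾(Γ)`: the set of generators occurring in a geodesic
word representing `g` (this set does not depend on the choice of geodesic). -/
def raagSupp {A : Type*} (Γ : SimpleGraph A) (g : RAAG Γ) : Set A :=
  {a | ∃ l : List (A × Bool), raagMk Γ (FreeGroup.mk l) = g ∧
        l.length = raagLen Γ g ∧ a ∈ l.map Prod.fst}

/-- `g` is cyclically reduced if `|g²| = 2|g|`. -/
def CyclicallyReduced {A : Type*} (Γ : SimpleGraph A) (g : RAAG Γ) : Prop :=
  raagLen Γ (g * g) = 2 * raagLen Γ g

/-- `g` is a block if the full subgraph of the non-commutation graph `Δ = Γᶜ` on the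
support `α(g)` is connected. -/
def IsBlock {A : Type*} (Γ : SimpleGraph A) (g : RAAG Γ) : Prop :=
  ((Γᶜ).induce (raagSupp Γ g)).Connected

/-- The canonical parabolic subgroup `ℍ = 𝔾(s)` of `𝔾(Γ)` generated by a set `s` of
vertices. -/
def parabolic {A : Type} (Γ : SimpleGraph A) (s : Set A) : Subgroup (RAAG Γ) :=
  Subgroup.closure (raagGen Γ '' s)

/-- Relators of `𝔾' = ⟨ 𝔾, t ∣ rel(𝔾), [t, C_𝔾(ℍ)] = 1 ⟩`, the extension of the
centraliser of the canonical parabolic subgroup `ℍ = 𝔾(s)`: the relators of `𝔾`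
(with generators relabelled by `some`), together with the commutators of the new
generator `t = none` with (words representing) all elements of `C_𝔾(ℍ)`. -/
def extRels {A : Type} (Γ : SimpleGraph A) (s : Set A) : Set (FreeGroup (Option A)) :=
  (⇑(FreeGroup.map (some : A → Option A)) '' raagRels Γ) ∪
    {r | ∃ u : FreeGroup A,
      raagMk Γ u ∈ Subgroup.centralizer (parabolic Γ s : Set (RAAG Γ)) ∧
      r = FreeGroup.of (none : Option A) * FreeGroup.map some u *
        (FreeGroup.of (none : Option A))⁻¹ * (FreeGroup.map some u)⁻¹}

/-- The group `𝔾' = ⟨ 𝔾, t ∣ rel(𝔾), [t, C_𝔾(ℍ)] = 1 ⟩`. -/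
abbrev ExtCentralizer {A : Type} (Γ : SimpleGraph A) (s : Set A) :=
  PresentedGroup (extRels Γ s)


/-! ### Free products of copies of one group -/

abbrev FPr (I : Type) (Z : Type) [Group Z] := Monoid.CoprodI (fun _ : I => Z)

def fpOf {I : Type} (Z : Type) [Group Z] (i : I) : Z →* FPr I Z :=
  Monoid.CoprodI.of (M := fun _ : I => Z) (i := i)

theorem fp_ext {I Z N : Type} [Group Z] [Group N] {f g : FPr I Z →* N}
    (h : ∀ i z, f (fpOf Z i z) = g (fpOf Z i z)) : f = g :=
  Monoid.CoprodI.ext_hom _ _ fun i => MonoidHom.ext fun z => h i z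

def fpLift {I Z N : Type} [Group Z] [Group N] (f : I → Z →* N) : FPr I Z →* N :=
  Monoid.CoprodI.lift f

theorem fpLift_of {I Z N : Type} [Group Z] [Group N] (f : I → Z →* N) (i : I) (z : Z) :
    fpLift f (fpOf Z i z) = f i z :=
  Monoid.CoprodI.lift_of (M := fun _ : I => Z) f z

def fpMap {I J Z Y : Type} [Group Z] [Group Y] (σ : I → J) (f : Z →* Y) : FPr I Z →* FPr J Y :=
  fpLift fun i => (fpOf Y (σ i)).comp f

theorem fpMap_of {I J Z Y : Type} [Group Z] [Group Y] (σ : I → J) (f : Z →* Y) (i : I) (z : Z) :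
    fpMap σ f (fpOf Z i z) = fpOf Y (σ i) (f z) :=
  fpLift_of _ _ _

theorem fpMap_inj {I J Z : Type} [Group Z] [Nonempty I] (σ : I → J) (h : Function.Injective σ) :
    Function.Injective (fpMap σ (MonoidHom.id Z)) := by
  have : (fpMap (Function.invFun σ) (MonoidHom.id Z)).comp (fpMap σ (MonoidHom.id Z))
      = MonoidHom.id _ := by
    apply fp_ext
    intro i z
    simp only [MonoidHom.comp_apply, fpMap_of, MonoidHom.id_apply,
      Function.leftInverse_invFun h i]
  intro x y hxy
  have h2 := congrArg (fpMap (Function.invFun σ) (MonoidHom.id Z)) hxy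
  rwa [← MonoidHom.comp_apply, ← MonoidHom.comp_apply, this] at h2

theorem fpOf_index {I Z : Type} [Group Z] {i j : I} {z : Z} (hz : z ≠ 1)
    (h : fpOf Z i z = fpOf Z j z) : i = j := by
  classical
  by_contra hij
  have := congrArg (fpLift (N := Z) (fun k => if k = i then MonoidHom.id Z else 1)) h
  rw [fpLift_of, fpLift_of, if_pos rfl, if_neg (Ne.symm hij)] at this
  exact hz this

/-- The finite list of letters which must survive for a nontrivial element to survive. -/
theorem fp_survive {I Z : Type} [Group Z] (x : FPr I Z) (hx : x ≠ 1) :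
    ∃ l : List Z, (∀ z ∈ l, z ≠ 1) ∧ ∀ (Y : Type) [Group Y] (f : Z →* Y),
      (∀ z ∈ l, f z ≠ 1) → fpMap (id : I → I) f x ≠ 1 := by
  classical
  obtain ⟨w, rfl⟩ := (Monoid.CoprodI.Word.equiv (M := fun _ : I => Z)).symm.surjective x
  change w.prod ≠ 1 at hx
  refine ⟨w.toList.map (fun p => p.2), ?_, ?_⟩
  · intro z hz
    obtain ⟨p, hp, rfl⟩ := List.mem_map.1 hz
    exact w.ne_one p hp
  · intro Y _ f hf
    let w' : Monoid.CoprodI.Word (fun _ : I => Y) :=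
      { toList := w.toList.map (fun p => ⟨p.1, f p.2⟩)
        ne_one := by
          intro l hl
          obtain ⟨p, hp, rfl⟩ := List.mem_map.1 hl
          exact hf _ (List.mem_map.2 ⟨p, hp, rfl⟩)
        chain_ne := by
          rw [List.isChain_map]
          exact w.chain_ne }
    have key : fpMap (id : I → I) f w.prod = w'.prod := by
      simp only [Monoid.CoprodI.Word.prod, map_list_prod, w', List.map_map]
      congr 1
    change fpMap (id : I → I) f w.prod ≠ 1
    rw [key]
    intro h1
    have h2 : w' = Monoid.CoprodI.Word.empty := by
      apply (Monoid.CoprodI.Word.equiv (M := fun _ : I => Y)).symm.injective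
      exact h1
    apply hx
    have h3 : w.toList = [] := by
      have := congrArg Monoid.CoprodI.Word.toList h2
      exact List.map_eq_nil_iff.1 this
    simp [Monoid.CoprodI.Word.prod, h3]

def fpAct (G : Type) [Group G] (L : Subgroup G) (Z : Type) [Group Z] :
    G →* MulAut (FPr (G ⧸ L) Z) where
  toFun g := MonoidHom.toMulEquiv (fpMap (fun q => g • q) (MonoidHom.id Z))
    (fpMap (fun q => g⁻¹ • q) (MonoidHom.id Z))
    (by apply fp_ext; intro i z; simp [fpMap_of])
    (by apply fp_ext; intro i z; simp [fpMap_of])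
  map_one' := by
    apply MulEquiv.toMonoidHom_injective
    apply fp_ext; intro i z
    change fpMap (fun q : G ⧸ L => (1 : G) • q) (MonoidHom.id Z) _ = _
    rw [fpMap_of]; simp
  map_mul' g h := by
    apply MulEquiv.toMonoidHom_injective
    apply fp_ext; intro i z
    change fpMap (fun q : G ⧸ L => (g * h) • q) (MonoidHom.id Z) (fpOf Z i z) =
      fpMap (fun q : G ⧸ L => g • q) (MonoidHom.id Z)
        (fpMap (fun q : G ⧸ L => h • q) (MonoidHom.id Z) (fpOf Z i z))
    rw [fpMap_of, fpMap_of, fpMap_of]; simp [mul_smul]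

theorem fpAct_of {G : Type} [Group G] (L : Subgroup G) (Z : Type) [Group Z] (g : G) (q : G ⧸ L)
    (z : Z) : fpAct G L Z g (fpOf Z q z) = fpOf Z (g • q) z :=
  fpMap_of _ _ _ _

/-- `(* of copies of Z indexed by G/L) ⋊ G`. -/
abbrev SPr (G : Type) [Group G] (L : Subgroup G) (Z : Type) [Group Z] :=
  FPr (G ⧸ L) Z ⋊[fpAct G L Z] G

def spT {G : Type} [Group G] (L : Subgroup G) {Z : Type} [Group Z] (g : G) (z : Z) : SPr G L Z :=
  SemidirectProduct.inl (fpOf Z (g : G ⧸ L) z)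

def spG {G : Type} [Group G] (L : Subgroup G) (Z : Type) [Group Z] : G →* SPr G L Z :=
  SemidirectProduct.inr

theorem spT_conj {G : Type} [Group G] (L : Subgroup G) {Z : Type} [Group Z] (g h : G) (z : Z) :
    spG L Z g * spT L h z * (spG L Z g)⁻¹ = spT L (g * h) z := by
  unfold spT spG
  rw [← map_inv, ← SemidirectProduct.inl_aut, fpAct_of]
  rfl

theorem spT_comm {G : Type} [Group G] (L : Subgroup G) {Z : Type} [Group Z] {l : G} (hl : l ∈ L)
    (z : Z) : Commute (spG L Z l) (spT L 1 z) := by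
  have h := spT_conj L l 1 z
  have : spT L (l * 1) z = spT L 1 z := by
    unfold spT
    congr 3
    rw [QuotientGroup.eq]
    simpa using hl
  rw [this] at h
  exact mul_inv_eq_iff_eq_mul.1 h

theorem spT_comm_iff {G : Type} [Group G] (L : Subgroup G) {Z : Type} [Group Z] {g : G} {z : Z}
    (hz : z ≠ 1) (h : Commute (spG L Z g) (spT L 1 z)) : g ∈ L := by
  have h1 := spT_conj L g 1 z
  rw [h.eq, mul_inv_cancel_right] at h1
  have h2 := fpOf_index hz (SemidirectProduct.inl_injective h1)
  rw [QuotientGroup.eq] at h2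
  simpa using h2

theorem spT_mul {G : Type} [Group G] (L : Subgroup G) {Z : Type} [Group Z] (g : G) (y z : Z) :
    spT L g (y * z) = spT L g y * spT L g z := by
  simp [spT]

def spTHom {G : Type} [Group G] (L : Subgroup G) (Z : Type) [Group Z] (g : G) : Z →* SPr G L Z :=
  MonoidHom.mk' (spT L g) (spT_mul L g)

noncomputable def spLift {G : Type} [Group G] (L : Subgroup G) {Z H : Type} [Group Z] [Group H]
    (ρ : G →* H) (ζ : Z →* H) (h : ∀ l ∈ L, ∀ z, Commute (ρ l) (ζ z)) : SPr G L Z →* H :=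
  SemidirectProduct.lift
    (fpLift fun q => (MulAut.conj (ρ q.out)).toMonoidHom.comp ζ) ρ (by
      intro g
      apply fp_ext
      intro q z
      have key : ∀ a b : G, (a : G ⧸ L) = b →
          ρ a * ζ z * (ρ a)⁻¹ = ρ b * ζ z * (ρ b)⁻¹ := by
        intro a b hab
        rw [QuotientGroup.eq] at hab
        have h1 := (h _ hab z).eq
        simp only [map_mul, map_inv] at h1
        have : ζ z = (ρ a)⁻¹ * ρ b * ζ z * (ρ b)⁻¹ * ρ a := by
          rw [h1]; group
        nth_rewrite 1 [this]
        group
      simp only [MonoidHom.comp_apply, MulEquiv.toMonoidHom_eq_coe, MonoidHom.coe_coe, fpAct_of,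
        fpLift_of, MulAut.conj_apply]
      rw [key (g • q).out (g * q.out) (by
        rw [QuotientGroup.out_eq']
        conv_lhs => rw [← QuotientGroup.out_eq' q]
        rfl)]
      simp [mul_assoc])

theorem spLift_G {G : Type} [Group G] (L : Subgroup G) {Z H : Type} [Group Z] [Group H]
    (ρ : G →* H) (ζ : Z →* H) (h : ∀ l ∈ L, ∀ z, Commute (ρ l) (ζ z)) (g : G) :
    spLift L ρ ζ h (spG L Z g) = ρ g :=
  SemidirectProduct.lift_inr _ _ _ _

theorem spLift_T {G : Type} [Group G] (L : Subgroup G) {Z H : Type} [Group Z] [Group H]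
    (ρ : G →* H) (ζ : Z →* H) (h : ∀ l ∈ L, ∀ z, Commute (ρ l) (ζ z)) (z : Z) :
    spLift L ρ ζ h (spT L 1 z) = ζ z := by
  unfold spLift spT
  rw [SemidirectProduct.lift_inl, fpLift_of]
  simp only [MonoidHom.comp_apply, MulEquiv.toMonoidHom_eq_coe, MonoidHom.coe_coe,
    MulAut.conj_apply]
  have h1 : (((1 : G) : G ⧸ L)).out ∈ L := by
    have := QuotientGroup.out_eq' ((1 : G) : G ⧸ L)
    rw [eq_comm, QuotientGroup.eq] at this
    simpa using this
  rw [(h _ h1 z).eq]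
  group

/-- Change of vertex group. -/
def spMapZ {G : Type} [Group G] (L : Subgroup G) {Z Y : Type} [Group Z] [Group Y] (f : Z →* Y) :
    SPr G L Z →* SPr G L Y :=
  SemidirectProduct.map (fpMap id f) (MonoidHom.id G) (by
    intro g; apply fp_ext; intro q z
    simp [fpAct_of, fpMap_of])

theorem spMapZ_survive {G : Type} [Group G] (L : Subgroup G) {Z : Type} [Group Z]
    (x : SPr G L Z) (hx : x ≠ 1) :
    ∃ l : List Z, (∀ z ∈ l, z ≠ 1) ∧ ∀ (Y : Type) [Group Y] (f : Z →* Y),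
      (∀ z ∈ l, f z ≠ 1) → spMapZ L f x ≠ 1 := by
  by_cases hr : x.right = 1
  · have hl : x.left ≠ 1 := fun h => hx (SemidirectProduct.ext h hr)
    obtain ⟨l, h1, h2⟩ := fp_survive x.left hl
    refine ⟨l, h1, fun Y _ f hf h => h2 Y f hf ?_⟩
    exact congrArg SemidirectProduct.left h
  · exact ⟨[], by simp, fun Y _ f _ h => hr (congrArg SemidirectProduct.right h)⟩

/-- Change of base group, sending the base point coset to the coset of `c`. -/
theorem spMapG_exists {G G₁ : Type} [Group G] [Group G₁] (L : Subgroup G) (K : Subgroup G₁)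
    (Z : Type) [Group Z] (i : G →* G₁) (hi : Function.Injective i) (c : G₁)
    (h : ∀ g, c⁻¹ * i g * c ∈ K ↔ g ∈ L) :
    ∃ M : SPr G L Z →* SPr G₁ K Z, Function.Injective M ∧
      (∀ g, M (spG L Z g) = spG K Z (i g)) ∧ ∀ z, M (spT L 1 z) = spT K c z := by
  let σ : G ⧸ L → G₁ ⧸ K := Quotient.map' (fun g => i g * c) (by
    intro a b hab
    rw [QuotientGroup.leftRel_apply] at hab ⊢
    rw [← h] at hab
    simpa [mul_assoc] using hab)
  have hσ : ∀ g : G, σ (g : G ⧸ L) = ((i g * c : G₁) : G₁ ⧸ K) := fun g => rfl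
  have hσi : Function.Injective σ := by
    intro p q
    induction p using QuotientGroup.induction_on with | H a =>
    induction q using QuotientGroup.induction_on with | H b =>
    rw [hσ, hσ, QuotientGroup.eq, QuotientGroup.eq, ← h]
    simp [mul_assoc]
  refine ⟨SemidirectProduct.map (fpMap σ (MonoidHom.id Z)) i ?_, ?_, ?_, ?_⟩
  · intro g; apply fp_ext; intro q z
    induction q using QuotientGroup.induction_on with | H a =>
    simp only [MonoidHom.comp_apply, MulEquiv.toMonoidHom_eq_coe, MonoidHom.coe_coe, fpAct_of,
      fpMap_of]
    congr 2
    change σ ((g * a : G) : G ⧸ L) = _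
    rw [hσ, hσ, map_mul, mul_assoc]
    rfl
  · intro x y hxy
    apply SemidirectProduct.ext
    · exact fpMap_inj σ hσi (congrArg SemidirectProduct.left hxy)
    · exact hi (congrArg SemidirectProduct.right hxy)
  · intro g; exact SemidirectProduct.map_inr _ _ _ _
  · intro z
    unfold spT
    rw [SemidirectProduct.map_inl, fpMap_of, hσ]
    simp

/-! ### Basics on right-angled Artin groups -/

theorem gen_comm {A : Type} (Γ : SimpleGraph A) {a b : A} (h : Γ.Adj a b) :
    Commute (raagGen Γ a) (raagGen Γ b) := by
  have : (PresentedGroup.mk (raagRels Γ)) (FreeGroup.of a * FreeGroup.of b * (FreeGroup.of a)⁻¹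
      * (FreeGroup.of b)⁻¹) = 1 := PresentedGroup.one_of_mem ⟨a, b, h, rfl⟩
  simp only [map_mul, map_inv] at this
  rw [mul_inv_eq_one, mul_inv_eq_iff_eq_mul] at this
  exact this

def rLift {A H : Type} [Group H] (Γ : SimpleGraph A) (f : A → H)
    (h : ∀ a b, Γ.Adj a b → Commute (f a) (f b)) : RAAG Γ →* H :=
  PresentedGroup.toGroup (f := f) (by
    rintro r ⟨a, b, hab, rfl⟩
    simp only [map_mul, map_inv, FreeGroup.lift_apply_of]
    rw [(h a b hab).eq]; group)

theorem rLift_gen {A H : Type} [Group H] (Γ : SimpleGraph A) (f : A → H)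
    (h : ∀ a b, Γ.Adj a b → Commute (f a) (f b)) (a : A) : rLift Γ f h (raagGen Γ a) = f a :=
  PresentedGroup.toGroup.of _

theorem r_ext {A H : Type} [Group H] {Γ : SimpleGraph A} {f g : RAAG Γ →* H}
    (h : ∀ a, f (raagGen Γ a) = g (raagGen Γ a)) : f = g :=
  PresentedGroup.ext h

theorem par_induction {A : Type} {Γ : SimpleGraph A} {s : Set A} {G H : Type} [Group G] [Group H]
    (f : RAAG Γ →* G) (K : Subgroup G)
    (hK : ∀ a ∈ s, f (raagGen Γ a) ∈ K) {x : RAAG Γ} (hx : x ∈ parabolic Γ s) : f x ∈ K := by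
  have : parabolic Γ s ≤ K.comap f := by
    unfold parabolic
    rw [Subgroup.closure_le]
    rintro _ ⟨a, ha, rfl⟩
    exact hK a ha
  exact this hx

theorem par_commute {A : Type} {Γ : SimpleGraph A} {s : Set A} {G : Type} [Group G]
    (f : RAAG Γ →* G) (y : G)
    (hK : ∀ a ∈ s, Commute (f (raagGen Γ a)) y) {x : RAAG Γ} (hx : x ∈ parabolic Γ s) :
    Commute (f x) y := by
  have := par_induction (H := G) f (Subgroup.centralizer {y}) (fun a ha => by
    rw [Subgroup.mem_centralizer_singleton_iff]; exact (hK a ha).eq) hx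
  rw [Subgroup.mem_centralizer_singleton_iff] at this
  exact this

open Classical in
noncomputable def rKeep {A : Type} (Γ : SimpleGraph A) (S : Set A) : RAAG Γ →* RAAG Γ :=
  rLift Γ (fun a => if a ∈ S then raagGen Γ a else 1) (by
    intro a b hab
    split_ifs
    · exact gen_comm Γ hab
    · exact Commute.one_right _
    · exact Commute.one_left _
    · exact Commute.one_left _)

theorem rKeep_in {A : Type} (Γ : SimpleGraph A) {S : Set A} {a : A} (h : a ∈ S) :
    rKeep Γ S (raagGen Γ a) = raagGen Γ a := by
  rw [rKeep, rLift_gen, if_pos h]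

theorem rKeep_out {A : Type} (Γ : SimpleGraph A) {S : Set A} {a : A} (h : a ∉ S) :
    rKeep Γ S (raagGen Γ a) = 1 := by
  rw [rKeep, rLift_gen, if_neg h]

theorem rKeep_par {A : Type} (Γ : SimpleGraph A) {S : Set A} {x : RAAG Γ}
    (hx : x ∈ parabolic Γ S) : rKeep Γ S x = x := by
  have : parabolic Γ S ≤ (rKeep Γ S).eqLocus (MonoidHom.id _) := by
    unfold parabolic
    rw [Subgroup.closure_le]
    rintro _ ⟨a, ha, rfl⟩
    exact rKeep_in Γ ha
  exact this hx

theorem par_gen {A : Type} (Γ : SimpleGraph A) {S : Set A} {a : A} (h : a ∈ S) :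
    raagGen Γ a ∈ parabolic Γ S := Subgroup.subset_closure ⟨a, h, rfl⟩

theorem par_inter {A : Type} (Γ : SimpleGraph A) {S T : Set A} {x : RAAG Γ}
    (hS : x ∈ parabolic Γ S) (hT : x ∈ parabolic Γ T) : x ∈ parabolic Γ (S ∩ T) := by
  rw [← rKeep_par Γ hT]
  refine par_induction (H := RAAG Γ) (rKeep Γ T) _ ?_ hS
  intro a ha
  by_cases h : a ∈ T
  · rw [rKeep_in Γ h]; exact par_gen Γ ⟨ha, h⟩
  · rw [rKeep_out Γ h]; exact one_mem _

/-! ### Adding a vertex -/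

def extG {A : Type} (Γ : SimpleGraph A) (C : Set A) : SimpleGraph (Option A) where
  Adj x y := match x, y with
    | some a, some b => Γ.Adj a b
    | some a, none => a ∈ C
    | none, some a => a ∈ C
    | none, none => False
  symm := ⟨by
    rintro (_ | a) (_ | b) h
    · exact h
    · exact h
    · exact h
    · exact SimpleGraph.Adj.symm (G := Γ) h⟩
  loopless := ⟨by
    rintro (_ | a) h
    · exact h
    · exact Γ.loopless.irrefl a h⟩

theorem extG_some {A : Type} {Γ : SimpleGraph A} {C : Set A} {a b : A} :
    (extG Γ C).Adj (some a) (some b) ↔ Γ.Adj a b := Iff.rfl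

/-- Homomorphism out of the extended group. -/
def eLift {A H : Type} [Group H] (Γ : SimpleGraph A) (C : Set A) (f : RAAG Γ →* H) (t : H)
    (h : ∀ a ∈ C, Commute (f (raagGen Γ a)) t) : RAAG (extG Γ C) →* H :=
  rLift (extG Γ C) (fun x => x.elim t (fun a => f (raagGen Γ a))) (by
    rintro (_ | a) (_ | b) hab
    · exact hab.elim
    · exact (h b hab).symm
    · exact h a hab
    · exact (gen_comm Γ hab).map f)

def eI {A : Type} (Γ : SimpleGraph A) (C : Set A) : RAAG Γ →* RAAG (extG Γ C) :=
  rLift Γ (fun a => raagGen (extG Γ C) (some a)) (by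
    intro a b hab
    exact gen_comm (extG Γ C) (extG_some.2 hab))

def eT {A : Type} (Γ : SimpleGraph A) (C : Set A) : RAAG (extG Γ C) := raagGen (extG Γ C) none

theorem eI_gen {A : Type} (Γ : SimpleGraph A) (C : Set A) (a : A) :
    eI Γ C (raagGen Γ a) = raagGen (extG Γ C) (some a) := rLift_gen _ _ _ _

theorem eLift_T {A H : Type} [Group H] (Γ : SimpleGraph A) (C : Set A) (f : RAAG Γ →* H) (t : H)
    (h : ∀ a ∈ C, Commute (f (raagGen Γ a)) t) : eLift Γ C f t h (eT Γ C) = t :=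
  rLift_gen _ _ _ _

theorem eLift_I {A H : Type} [Group H] (Γ : SimpleGraph A) (C : Set A) (f : RAAG Γ →* H) (t : H)
    (h : ∀ a ∈ C, Commute (f (raagGen Γ a)) t) (x : RAAG Γ) : eLift Γ C f t h (eI Γ C x) = f x := by
  have : (eLift Γ C f t h).comp (eI Γ C) = f := by
    apply r_ext
    intro a
    rw [MonoidHom.comp_apply, eI_gen]
    exact rLift_gen _ _ _ _
  exact DFunLike.congr_fun this x

theorem e_ext {A H : Type} [Group H] {Γ : SimpleGraph A} {C : Set A}
    {f g : RAAG (extG Γ C) →* H} (h1 : f (eT Γ C) = g (eT Γ C))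
    (h2 : ∀ a, f (eI Γ C (raagGen Γ a)) = g (eI Γ C (raagGen Γ a))) : f = g := by
  apply r_ext
  rintro (_ | a)
  · exact h1
  · have := h2 a
    rwa [eI_gen] at this

theorem eT_comm {A : Type} (Γ : SimpleGraph A) (C : Set A) {a : A} (h : a ∈ C) :
    Commute (eI Γ C (raagGen Γ a)) (eT Γ C) := by
  rw [eI_gen]
  exact gen_comm (extG Γ C) (a := some a) (b := none) h

theorem eT_comm_par {A : Type} (Γ : SimpleGraph A) (C : Set A) {x : RAAG Γ}
    (h : x ∈ parabolic Γ C) : Commute (eI Γ C x) (eT Γ C) :=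
  par_commute (eI Γ C) _ (fun _ ha => eT_comm Γ C ha) h

abbrev ZZ := Multiplicative ℤ

def oneZ : ZZ := Multiplicative.ofAdd 1

theorem oneZ_ne : oneZ ≠ 1 := by
  intro h
  have := congrArg Multiplicative.toAdd h
  simp [oneZ] at this

/-- The splitting of the extended group. -/
def eTheta {A : Type} (Γ : SimpleGraph A) (C : Set A) :
    RAAG (extG Γ C) →* SPr (RAAG Γ) (parabolic Γ C) ZZ :=
  eLift Γ C (spG _ ZZ) (spT _ 1 oneZ) (fun _ ha => spT_comm _ (par_gen Γ ha) _)

theorem eTheta_inj {A : Type} (Γ : SimpleGraph A) (C : Set A) :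
    Function.Injective (eTheta Γ C) := by
  have : (spLift (parabolic Γ C) (eI Γ C) (zpowersHom _ (eT Γ C)) (by
      intro l hl z
      rw [zpowersHom_apply]
      exact (eT_comm_par Γ C hl).zpow_right _)).comp (eTheta Γ C) = MonoidHom.id _ := by
    apply e_ext
    · rw [MonoidHom.comp_apply, eTheta, eLift_T, spLift_T, zpowersHom_apply]
      simp [oneZ]
    · intro a
      rw [MonoidHom.comp_apply, eTheta, eLift_I, spLift_G]
      rfl
  intro x y hxy
  have h2 := congrArg (spLift (parabolic Γ C) (eI Γ C) (zpowersHom _ (eT Γ C)) (by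
      intro l hl z
      rw [zpowersHom_apply]
      exact (eT_comm_par Γ C hl).zpow_right _)) hxy
  rwa [← MonoidHom.comp_apply, ← MonoidHom.comp_apply, this] at h2

theorem eT_comm_iff {A : Type} (Γ : SimpleGraph A) (C : Set A) {x : RAAG Γ}
    (h : Commute (eI Γ C x) (eT Γ C)) : x ∈ parabolic Γ C := by
  have := h.map (eTheta Γ C)
  rw [eTheta, eLift_I, eLift_T] at this
  exact spT_comm_iff _ oneZ_ne this

def eRetr {A : Type} (Γ : SimpleGraph A) (C : Set A) : RAAG (extG Γ C) →* RAAG Γ :=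
  eLift Γ C (MonoidHom.id _) 1 (fun _ _ => Commute.one_right _)

theorem eRetr_I {A : Type} (Γ : SimpleGraph A) (C : Set A) (x : RAAG Γ) :
    eRetr Γ C (eI Γ C x) = x := eLift_I _ _ _ _ _ _

theorem eI_inj {A : Type} (Γ : SimpleGraph A) (C : Set A) : Function.Injective (eI Γ C) :=
  Function.LeftInverse.injective (eRetr_I Γ C)

/-- If `t⁻¹ x t` lies in the base then `x` lies in the centralised subgroup. -/
theorem eT_conj {A : Type} (Γ : SimpleGraph A) (C : Set A) {x y : RAAG Γ}
    (h : (eT Γ C)⁻¹ * eI Γ C x * eT Γ C = eI Γ C y) : x = y ∧ x ∈ parabolic Γ C := by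
  have h1 := congrArg (eRetr Γ C) h
  have h0 : eRetr Γ C (eT Γ C) = 1 := eLift_T _ _ _ _ _
  simp only [map_mul, map_inv, eRetr_I, h0, inv_one, one_mul, mul_one] at h1
  refine ⟨h1, eT_comm_iff Γ C ?_⟩
  rw [← h1, mul_assoc, inv_mul_eq_iff_eq_mul] at h
  exact h

/-! ### Doubling a vertex -/

def lkG {A : Type} (Γ : SimpleGraph A) (b : A) : Set A := {v | Γ.Adj b v}

def stG {A : Type} (Γ : SimpleGraph A) (b : A) : Set A := {v | v = b ∨ Γ.Adj b v}

open Classical in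
noncomputable def bHom {A Z : Type} [Group Z] (Γ : SimpleGraph A) (b : A) (z : Z) :
    RAAG Γ →* SPr (RAAG Γ) (parabolic Γ (lkG Γ b)) Z :=
  rLift Γ (fun a => if a = b then spT _ 1 z else spG _ Z (raagGen Γ a)) (by
    intro a c hac
    split_ifs with h1 h2 h2
    · exact Commute.refl _
    · subst h1
      exact (spT_comm _ (par_gen Γ hac) z).symm
    · subst h2
      exact spT_comm _ (par_gen Γ hac.symm) z
    · exact (gen_comm Γ hac).map _)

theorem bHom_b {A Z : Type} [Group Z] (Γ : SimpleGraph A) (b : A) (z : Z) :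
    bHom Γ b z (raagGen Γ b) = spT _ 1 z := by
  rw [bHom, rLift_gen, if_pos rfl]

theorem bHom_ne {A Z : Type} [Group Z] (Γ : SimpleGraph A) {b a : A} (z : Z) (h : a ≠ b) :
    bHom Γ b z (raagGen Γ a) = spG _ Z (raagGen Γ a) := by
  rw [bHom, rLift_gen, if_neg h]

abbrev Z2 := Multiplicative (ℤ × ℤ)

def z10 : Z2 := Multiplicative.ofAdd (1, 0)
def z01 : Z2 := Multiplicative.ofAdd (0, 1)

noncomputable def twinPsi {A : Type} (Γ : SimpleGraph A) (b : A) :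
    RAAG (extG Γ (stG Γ b)) →* SPr (RAAG Γ) (parabolic Γ (lkG Γ b)) Z2 :=
  eLift Γ (stG Γ b) (bHom Γ b z10) (spT _ 1 z01) (by
    rintro a (rfl | ha)
    · rw [bHom_b]
      rw [commute_iff_eq, ← spT_mul, ← spT_mul, mul_comm]
    · rw [bHom_ne Γ _ (Γ.ne_of_adj ha).symm]
      exact spT_comm _ (par_gen Γ ha) _)

/-- The homomorphism `ℤ² → H` given by two commuting elements. -/
def z2Hom {H : Type} [Group H] (x y : H) (h : Commute x y) : Z2 →* H :=
  MonoidHom.mk' (fun z => x ^ (Multiplicative.toAdd z).1 * y ^ (Multiplicative.toAdd z).2) (by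
    intro a b
    simp only [toAdd_mul, Prod.fst_add, Prod.snd_add, zpow_add]
    have := (h.zpow_zpow (Multiplicative.toAdd b).1 (Multiplicative.toAdd a).2).eq
    simp only [mul_assoc]
    congr 1
    simp only [← mul_assoc]
    rw [this])

theorem z2Hom_10 {H : Type} [Group H] (x y : H) (h : Commute x y) : z2Hom x y h z10 = x := by
  simp [z2Hom, z10]

theorem z2Hom_01 {H : Type} [Group H] (x y : H) (h : Commute x y) : z2Hom x y h z01 = y := by
  simp [z2Hom, z01]

theorem twinPsi_inj {A : Type} (Γ : SimpleGraph A) (b : A) :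
    Function.Injective (twinPsi Γ b) := by
  have hb : b ∈ stG Γ b := Or.inl rfl
  have hc := eT_comm Γ (stG Γ b) hb
  have hl : ∀ l ∈ parabolic Γ (lkG Γ b), ∀ z,
      Commute (((eI Γ (stG Γ b)).comp (rKeep Γ {b}ᶜ)) l) (z2Hom _ _ hc z) := by
    intro l hl z
    refine par_commute _ _ ?_ hl
    intro a ha
    have hne : a ∈ ({b}ᶜ : Set A) := (Γ.ne_of_adj ha).symm
    rw [MonoidHom.comp_apply, rKeep_in Γ hne]
    have hz : z2Hom _ _ hc z = eI Γ (stG Γ b) (raagGen Γ b) ^ (Multiplicative.toAdd z).1 *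
      eT Γ (stG Γ b) ^ (Multiplicative.toAdd z).2 := rfl
    rw [hz]
    apply Commute.mul_right
    · apply Commute.zpow_right
      exact (gen_comm Γ (SimpleGraph.Adj.symm ha)).map _
    · apply Commute.zpow_right
      exact eT_comm Γ _ (Or.inr ha)
  have : (spLift (parabolic Γ (lkG Γ b)) _ _ hl).comp (twinPsi Γ b) = MonoidHom.id _ := by
    apply e_ext
    · rw [MonoidHom.comp_apply, twinPsi, eLift_T, spLift_T, z2Hom_01]
      rfl
    · intro a
      rw [MonoidHom.comp_apply, twinPsi, eLift_I]
      by_cases h : a = b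
      · subst h
        rw [bHom_b, spLift_T, z2Hom_10]
        rfl
      · have hne : a ∈ ({b}ᶜ : Set A) := h
        rw [bHom_ne Γ _ h, spLift_G, MonoidHom.comp_apply, rKeep_in Γ hne]
        rfl
  intro x y hxy
  have h2 := congrArg (spLift (parabolic Γ (lkG Γ b)) _ _ hl) hxy
  rwa [← MonoidHom.comp_apply, ← MonoidHom.comp_apply, this] at h2

def twinPhi {A : Type} (Γ : SimpleGraph A) (b : A) (N : ℤ) :
    RAAG (extG Γ (stG Γ b)) →* RAAG Γ :=
  eLift Γ (stG Γ b) (MonoidHom.id _) (raagGen Γ b ^ N) (by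
    rintro a (rfl | ha)
    · exact (Commute.refl _).zpow_right _
    · exact (gen_comm Γ (SimpleGraph.Adj.symm ha)).zpow_right _)

theorem twin_square {A : Type} (Γ : SimpleGraph A) (b : A) (N : ℤ)
    (x : RAAG (extG Γ (stG Γ b))) :
    bHom Γ b oneZ (twinPhi Γ b N x) =
      spMapZ _ (z2Hom oneZ (oneZ ^ N) (Commute.all _ _)) (twinPsi Γ b x) := by
  have hT : ∀ (z : Z2) (f : Z2 →* ZZ), spMapZ (parabolic Γ (lkG Γ b)) f (spT _ 1 z) =
      spT _ 1 (f z) := by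
    intro z f
    unfold spMapZ spT
    rw [SemidirectProduct.map_inl, fpMap_of]
    rfl
  have hG : ∀ (g : RAAG Γ) (f : Z2 →* ZZ), spMapZ (parabolic Γ (lkG Γ b)) f (spG _ _ g) =
      spG _ _ g := by
    intro z f
    unfold spMapZ spG
    rw [SemidirectProduct.map_inr]
    rfl
  have : (bHom Γ b oneZ).comp (twinPhi Γ b N) =
      (spMapZ _ (z2Hom oneZ (oneZ ^ N) (Commute.all _ _))).comp (twinPsi Γ b) := by
    apply e_ext
    · rw [MonoidHom.comp_apply, MonoidHom.comp_apply, twinPhi, twinPsi, eLift_T, eLift_T, hT,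
        z2Hom_01, map_zpow, bHom_b]
      exact (map_zpow (spTHom _ ZZ 1) oneZ N).symm
    · intro a
      rw [MonoidHom.comp_apply, MonoidHom.comp_apply, twinPhi, twinPsi, eLift_I, eLift_I,
        MonoidHom.id_apply]
      by_cases h : a = b
      · subst h
        rw [bHom_b, bHom_b, hT, z2Hom_10]
      · rw [bHom_ne Γ _ h, bHom_ne Γ _ h, hG]
  exact DFunLike.congr_fun this x

theorem twin_finite {A : Type} (Γ : SimpleGraph A) (b : A)
    (x : RAAG (extG Γ (stG Γ b))) (hx : x ≠ 1) : {N : ℤ | twinPhi Γ b N x = 1}.Finite := by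
  have hx' : twinPsi Γ b x ≠ 1 := fun h => hx (twinPsi_inj Γ b (by rw [h, map_one]))
  obtain ⟨l, h1, h2⟩ := spMapZ_survive _ _ hx'
  have hz : ∀ z ∈ l, {N : ℤ | z2Hom oneZ (oneZ ^ N) (Commute.all _ _) z = 1}.Finite := by
    intro z hz
    apply Set.Subsingleton.finite
    have key : ∀ N : ℤ, z2Hom oneZ (oneZ ^ N) (Commute.all _ _) z = 1 →
        (Multiplicative.toAdd z).1 + N * (Multiplicative.toAdd z).2 = 0 := by
      intro N hN
      have := congrArg Multiplicative.toAdd hN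
      simp only [z2Hom, MonoidHom.mk'_apply, toAdd_mul, toAdd_zpow, oneZ, toAdd_ofAdd, toAdd_one,
        smul_eq_mul, mul_one] at this
      linarith
    intro N hN M hM
    have e1 := key N hN
    have e2 := key M hM
    by_contra hne
    have e3 : (N - M) * (Multiplicative.toAdd z).2 = 0 := by linear_combination e1 - e2
    have e4 : (Multiplicative.toAdd z).2 = 0 := by
      rcases mul_eq_zero.1 e3 with h | h
      · exact (hne (sub_eq_zero.1 h)).elim
      · exact h
    rw [e4, mul_zero, add_zero] at e1
    exact h1 z hz (Multiplicative.toAdd.injective (Prod.ext e1 e4))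
  have hfin : (⋃ z ∈ {z | z ∈ l},
      {N : ℤ | z2Hom oneZ (oneZ ^ N) (Commute.all _ _) z = 1}).Finite :=
    Set.Finite.biUnion (List.finite_toSet l) hz
  refine hfin.subset ?_
  intro N hN
  by_contra hcon
  simp only [Set.mem_iUnion, not_exists] at hcon
  apply h2 ZZ (z2Hom oneZ (oneZ ^ N) (Commute.all _ _)) (fun z hz h => hcon z hz h)
  rw [← twin_square, show twinPhi Γ b N x = 1 from hN, map_one]

theorem twin_discr {A : Type} (Γ : SimpleGraph A) (b : A)
    (T : Finset (RAAG (extG Γ (stG Γ b)))) (hT : ∀ x ∈ T, x ≠ 1) :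
    ∃ N : ℤ, ∀ x ∈ T, twinPhi Γ b N x ≠ 1 := by
  have hfin : (⋃ x ∈ T, {N : ℤ | twinPhi Γ b N x = 1}).Finite :=
    Set.Finite.biUnion T.finite_toSet (fun x hx => twin_finite Γ b x (hT x hx))
  obtain ⟨N, hN⟩ := hfin.exists_notMem
  refine ⟨N, fun x hx h => hN ?_⟩
  simp only [Set.mem_iUnion]
  exact ⟨x, hx, h⟩

theorem twinPhi_I {A : Type} (Γ : SimpleGraph A) (b : A) (N : ℤ) (x : RAAG Γ) :
    twinPhi Γ b N (eI Γ _ x) = x := eLift_I _ _ _ _ _ _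

/-- Centralisers of vertices. -/
theorem cent_vertex {A : Type} (Γ : SimpleGraph A) (b : A) {x : RAAG Γ}
    (h : Commute x (raagGen Γ b)) : x ∈ parabolic Γ (stG Γ b) := by
  apply eT_comm_iff
  by_contra hc
  have hne : eI Γ (stG Γ b) x * eT Γ (stG Γ b) * (eI Γ (stG Γ b) x)⁻¹ * (eT Γ (stG Γ b))⁻¹ ≠ 1 := by
    intro h1
    apply hc
    rw [mul_inv_eq_one, mul_inv_eq_iff_eq_mul] at h1
    exact h1
  obtain ⟨N, hN⟩ := twin_discr Γ b {_} (by
    intro y hy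
    rw [Finset.mem_singleton] at hy
    rw [hy]; exact hne)
  apply hN _ (Finset.mem_singleton_self _)
  have h0 : twinPhi Γ b N (eT Γ (stG Γ b)) = raagGen Γ b ^ N := eLift_T _ _ _ _ _
  simp only [map_mul, map_inv, twinPhi_I, h0]
  rw [(h.zpow_right N).eq]
  group

def csG {A : Type} (Γ : SimpleGraph A) (s : Set A) : Set A := {v | ∀ a ∈ s, v = a ∨ Γ.Adj a v}

theorem csG_single {A : Type} (Γ : SimpleGraph A) (b : A) : csG Γ {b} = stG Γ b := by
  ext v; simp [csG, stG]

theorem csG_insert {A : Type} (Γ : SimpleGraph A) (b : A) (s : Set A) :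
    csG Γ (insert b s) = csG Γ s ∩ stG Γ b := by
  ext v; simp [csG, stG, and_comm]

theorem cent_par {A : Type} [Finite A] (Γ : SimpleGraph A) (s : Set A) {x : RAAG Γ}
    (h : ∀ a ∈ s, Commute x (raagGen Γ a)) : x ∈ parabolic Γ (csG Γ s) := by
  have hs := s.toFinite
  induction s, hs using Set.Finite.induction_on with
  | empty =>
    have h1 : csG Γ ∅ = Set.univ := by ext v; simp [csG]
    have h2 : parabolic Γ Set.univ = ⊤ := by
      unfold parabolic
      rw [Set.image_univ]
      exact PresentedGroup.closure_range_of _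
    rw [h1, h2]; trivial
  | insert _ _ ih =>
    rw [csG_insert]
    exact par_inter Γ (ih fun a ha => h a (Or.inr ha)) (cent_vertex Γ _ (h _ (Or.inl rfl)))

/-! ### The discrimination theorem for the extended graph -/

def Discr {A : Type} (Γ : SimpleGraph A) (s : Set A) : Prop :=
  ∀ T : Finset (RAAG (extG Γ (csG Γ s))), (∀ x ∈ T, x ≠ 1) →
    ∃ φ : RAAG (extG Γ (csG Γ s)) →* RAAG Γ, (∀ g, φ (eI Γ _ g) = g) ∧ ∀ x ∈ T, φ x ≠ 1

theorem discr_single {A : Type} (Γ : SimpleGraph A) (b : A) : Discr Γ {b} := by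
  unfold Discr
  rw [csG_single]
  intro T hT
  obtain ⟨N, hN⟩ := twin_discr Γ b T hT
  exact ⟨twinPhi Γ b N, twinPhi_I Γ b N, hN⟩

theorem discr_insert {A : Type} (Γ : SimpleGraph A) (b : A) (s : Set A) (hs : Discr Γ s)
    (hb : b ∉ csG Γ s) : Discr Γ (insert b s) := by
  classical
  unfold Discr
  rw [csG_insert]
  set C := csG Γ s with hC
  intro T hT
  -- the first extension and the doubling of `b` in it
  let Λ := extG Γ C
  have hst : stG Λ (some b) = some '' stG Γ b := by
    ext (_ | v)
    · simp only [stG, Set.mem_ofPred_eq, Set.mem_image]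
      constructor
      · rintro (h | h)
        · cases h
        · exact (hb h).elim
      · rintro ⟨v, _, h⟩
        cases h
    · simp only [stG, Set.mem_ofPred_eq, Set.mem_image, Option.some.injEq, exists_eq_right]
      rfl
  let K := parabolic Λ (stG Λ (some b))
  have hKsub : ∀ y, y ∈ K ↔ ∃ g ∈ parabolic Γ (stG Γ b), eI Γ C g = y := by
    intro y
    have : K = (parabolic Γ (stG Γ b)).map (eI Γ C) := by
      simp only [K, parabolic, hst, MonoidHom.map_closure, Set.image_image, eI_gen]
      rfl
    rw [this]; rfl
  have hcond : ∀ g, (eT Γ C)⁻¹ * eI Γ C g * eT Γ C ∈ K ↔ g ∈ parabolic Γ (C ∩ stG Γ b) := by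
    intro g
    rw [hKsub]
    constructor
    · rintro ⟨y, hy, h⟩
      obtain ⟨rfl, h2⟩ := eT_conj Γ C h.symm
      exact par_inter Γ h2 hy
    · intro hg
      have h1 : parabolic Γ (C ∩ stG Γ b) ≤ parabolic Γ C :=
        Subgroup.closure_mono (Set.image_mono Set.inter_subset_left)
      have h2 : parabolic Γ (C ∩ stG Γ b) ≤ parabolic Γ (stG Γ b) :=
        Subgroup.closure_mono (Set.image_mono Set.inter_subset_right)
      refine ⟨g, h2 hg, ?_⟩
      rw [mul_assoc, (eT_comm_par Γ C (h1 hg)).eq, inv_mul_cancel_left]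
  obtain ⟨M, hMinj, hMG, hMT⟩ := spMapG_exists (parabolic Γ (C ∩ stG Γ b)) K ZZ (eI Γ C)
    (eI_inj Γ C) (eT Γ C) hcond
  -- the embedding of the extension in the doubled group
  let t1 := eI Λ (stG Λ (some b)) (eT Γ C)
  let t2 := eT Λ (stG Λ (some b))
  let i2 := (eI Λ (stG Λ (some b))).comp (eI Γ C)
  have hθ : ∀ x, eTheta Λ (stG Λ (some b)) (eI Λ _ x) = spG _ _ x := fun x => eLift_I _ _ _ _ _ _
  have hθT : eTheta Λ (stG Λ (some b)) (eT Λ _) = spT _ 1 oneZ := eLift_T _ _ _ _ _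
  have ht : eTheta Λ (stG Λ (some b)) (t1 * t2 * t1⁻¹) = spT K (eT Γ C) oneZ := by
    simp only [t1, t2, map_mul, map_inv, hθ, hθT]
    rw [spT_conj, mul_one]
  let E : RAAG (extG Γ (C ∩ stG Γ b)) →* RAAG (extG Λ (stG Λ (some b))) :=
    eLift Γ _ i2 (t1 * t2 * t1⁻¹) (by
      intro a ha
      have e1 : Commute (i2 (raagGen Γ a)) t1 :=
        (eT_comm Γ C ha.1).map (eI Λ (stG Λ (some b)))
      have e2 : Commute (i2 (raagGen Γ a)) t2 := by
        have := eT_comm Λ (stG Λ (some b)) (a := some a) (by rw [hst]; exact ⟨a, ha.2, rfl⟩)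
        rw [← eI_gen] at this
        exact this
      exact (e1.mul_right e2).mul_right e1.inv_right)
  have hEI : ∀ g, E (eI Γ _ g) = i2 g := fun g => eLift_I _ _ _ _ _ _
  have hsq : (eTheta Λ (stG Λ (some b))).comp E = M.comp (eTheta Γ (C ∩ stG Γ b)) := by
    apply e_ext
    · have h1 : eTheta Γ (C ∩ stG Γ b) (eT Γ _) = spT _ 1 oneZ := eLift_T _ _ _ _ _
      have h2 : E (eT Γ _) = t1 * t2 * t1⁻¹ := eLift_T _ _ _ _ _
      rw [MonoidHom.comp_apply, MonoidHom.comp_apply, h1, h2, hMT, ht]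
    · intro a
      rw [MonoidHom.comp_apply, MonoidHom.comp_apply, hEI]
      have : eTheta Γ (C ∩ stG Γ b) (eI Γ _ (raagGen Γ a)) = spG _ _ (raagGen Γ a) :=
        eLift_I _ _ _ _ _ _
      rw [this, hMG]
      exact hθ (eI Γ C (raagGen Γ a))
  have hEinj : Function.Injective E := by
    have h1 : Function.Injective ((eTheta Λ (stG Λ (some b))).comp E) := by
      rw [hsq]
      exact hMinj.comp (eTheta_inj _ _)
    exact Function.Injective.of_comp h1
  obtain ⟨N, hN⟩ := twin_discr Λ (some b) (T.image E) (by
    intro y hy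
    obtain ⟨x, hx, rfl⟩ := Finset.mem_image.1 hy
    exact fun h => hT x hx (hEinj (by rw [h, map_one])))
  obtain ⟨φ, hφ1, hφ2⟩ := hs ((T.image E).image (twinPhi Λ (some b) N)) (by
    intro y hy
    obtain ⟨x, hx, rfl⟩ := Finset.mem_image.1 hy
    exact hN x hx)
  refine ⟨φ.comp ((twinPhi Λ (some b) N).comp E), ?_, ?_⟩
  · intro g
    rw [MonoidHom.comp_apply, MonoidHom.comp_apply, hEI]
    change φ (twinPhi Λ (some b) N (eI Λ _ (eI Γ C g))) = g
    rw [twinPhi_I]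
    exact hφ1 g
  · intro x hx
    exact hφ2 _ (Finset.mem_image_of_mem _ (Finset.mem_image_of_mem _ hx))

theorem discr_conn {A : Type} [Finite A] (Γ : SimpleGraph A) (s : Set A)
    (hind : ((Γᶜ).induce s).Connected) : Discr Γ s := by
  obtain ⟨⟨a0, ha0⟩⟩ := hind.nonempty
  have hfin : {u : Set A | u ⊆ s ∧ a0 ∈ u ∧ Discr Γ u}.Finite := Set.toFinite _
  obtain ⟨u, ⟨hus, hau, hu⟩, hmax⟩ := hfin.exists_maximal
    ⟨{a0}, by simpa using ha0, rfl, discr_single Γ a0⟩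
  by_cases hsu : s ⊆ u
  · rwa [Set.Subset.antisymm hsu hus]
  exfalso
  obtain ⟨c, hc, hcu⟩ := Set.not_subset.1 hsu
  obtain ⟨p⟩ := hind.preconnected ⟨a0, ha0⟩ ⟨c, hc⟩
  obtain ⟨d, -, hd1, hd2⟩ := p.exists_boundary_dart (Subtype.val ⁻¹' u) hau hcu
  have hadj : Γᶜ.Adj d.fst.1 d.snd.1 := d.adj
  rw [SimpleGraph.compl_adj] at hadj
  have hD : Discr Γ (insert d.snd.1 u) := by
    apply discr_insert Γ _ _ hu
    intro h
    rcases h _ hd1 with h | h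
    · exact hadj.1 h.symm
    · exact hadj.2 h
  have := hmax (y := insert d.snd.1 u) ⟨Set.insert_subset d.snd.2 hus, Or.inr hau, hD⟩
    (Set.subset_insert _ _)
  exact hd2 (this (Or.inl rfl))

/-! ### Identification of the extension of the centraliser -/

def extFwd {A : Type} [Finite A] (Γ : SimpleGraph A) (s : Set A) :
    ExtCentralizer Γ s →* RAAG (extG Γ (csG Γ s)) :=
  PresentedGroup.toGroup (f := raagGen (extG Γ (csG Γ s))) (by
    have hmap : ∀ u : FreeGroup A, FreeGroup.lift (raagGen (extG Γ (csG Γ s)))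
        (FreeGroup.map some u) = eI Γ (csG Γ s) (raagMk Γ u) := by
      intro u
      have : (FreeGroup.lift (raagGen (extG Γ (csG Γ s)))).comp (FreeGroup.map some) =
          (eI Γ (csG Γ s)).comp (raagMk Γ) := by
        apply FreeGroup.ext_hom
        intro a
        simp only [MonoidHom.comp_apply, FreeGroup.map.of, FreeGroup.lift_apply_of]
        exact (eI_gen Γ _ a).symm
      exact DFunLike.congr_fun this u
    rintro r (⟨u, hu, rfl⟩ | ⟨u, hu, rfl⟩)
    · rw [hmap]
      have : raagMk Γ u = 1 := PresentedGroup.one_of_mem hu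
      rw [this, map_one]
    · simp only [map_mul, map_inv, hmap, FreeGroup.lift_apply_of]
      have hx : raagMk Γ u ∈ parabolic Γ (csG Γ s) := by
        apply cent_par
        intro a ha
        exact (Subgroup.mem_centralizer_iff.1 hu _ (par_gen Γ ha)).symm
      have := (eT_comm_par Γ _ hx).eq
      change eT Γ _ * _ * (eT Γ _)⁻¹ * _ = 1
      rw [← this]
      group)

theorem extFwd_of {A : Type} [Finite A] (Γ : SimpleGraph A) (s : Set A) (a : Option A) :
    extFwd Γ s (PresentedGroup.of a) = raagGen _ a := PresentedGroup.toGroup.of _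

def extJ {A : Type} (Γ : SimpleGraph A) (s : Set A) : RAAG Γ →* ExtCentralizer Γ s :=
  rLift Γ (fun a => PresentedGroup.of (some a)) (by
    intro a b hab
    have : PresentedGroup.mk (extRels Γ s) (FreeGroup.map some (FreeGroup.of a * FreeGroup.of b
        * (FreeGroup.of a)⁻¹ * (FreeGroup.of b)⁻¹)) = 1 :=
      PresentedGroup.one_of_mem (Or.inl ⟨_, ⟨a, b, hab, rfl⟩, rfl⟩)
    simp only [map_mul, map_inv, FreeGroup.map.of] at this
    rw [mul_inv_eq_one, mul_inv_eq_iff_eq_mul] at this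
    exact this)

theorem extJ_gen {A : Type} (Γ : SimpleGraph A) (s : Set A) (a : A) :
    extJ Γ s (raagGen Γ a) = PresentedGroup.of (some a) := rLift_gen _ _ _ _

def extBwd {A : Type} (Γ : SimpleGraph A) (s : Set A) :
    RAAG (extG Γ (csG Γ s)) →* ExtCentralizer Γ s :=
  eLift Γ _ (extJ Γ s) (PresentedGroup.of none) (by
    intro a ha
    rw [extJ_gen]
    have hmem : raagMk Γ (FreeGroup.of a) ∈
        Subgroup.centralizer (parabolic Γ s : Set (RAAG Γ)) := by
      unfold parabolic
      rw [Subgroup.centralizer_closure, Subgroup.mem_centralizer_iff]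
      rintro _ ⟨b, hb, rfl⟩
      change raagGen Γ b * raagGen Γ a = raagGen Γ a * raagGen Γ b
      rcases ha b hb with h | h
      · rw [h]
      · exact (gen_comm Γ h).eq
    have : PresentedGroup.mk (extRels Γ s) (FreeGroup.of (none : Option A) *
        FreeGroup.map some (FreeGroup.of a) *
        (FreeGroup.of (none : Option A))⁻¹ * (FreeGroup.map some (FreeGroup.of a))⁻¹) = 1 :=
      PresentedGroup.one_of_mem (Or.inr ⟨_, hmem, rfl⟩)
    simp only [map_mul, map_inv, FreeGroup.map.of] at this
    rw [mul_inv_eq_one, mul_inv_eq_iff_eq_mul] at this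
    exact this.symm)

def extEquiv {A : Type} [Finite A] (Γ : SimpleGraph A) (s : Set A) :
    ExtCentralizer Γ s ≃* RAAG (extG Γ (csG Γ s)) :=
  MonoidHom.toMulEquiv (extFwd Γ s) (extBwd Γ s)
    (by
      apply PresentedGroup.ext
      rintro (_ | a)
      · rw [MonoidHom.comp_apply, extFwd_of]
        exact eLift_T _ _ _ _ _
      · rw [MonoidHom.comp_apply, extFwd_of, ← eI_gen, extBwd, eLift_I, extJ_gen]
        rfl)
    (by
      apply e_ext
      · rw [MonoidHom.comp_apply, extBwd, eLift_T, extFwd_of]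
        rfl
      · intro a
        rw [MonoidHom.comp_apply, extBwd, eLift_I, extJ_gen, extFwd_of, eI_gen]
        rfl)

/-- If `ℍ = 𝔾(s)` is a directly indecomposable canonical parabolic subgroup of `𝔾`
(equivalently, the complement of its defining graph is connected), then
`𝔾' = ⟨ 𝔾, t ∣ rel(𝔾), [t, C_𝔾(ℍ)] = 1 ⟩` is a right-angled Artin group and is
`𝔾`-discriminated by `𝔾`: every finite set of nontrivial elements of `𝔾'` is mapped to
nontrivial elements by some `𝔾`-homomorphism `𝔾' → 𝔾`. -/
theorem extension_of_centralizer_discriminated {A : Type} [Fintype A]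
    (Γ : SimpleGraph A) (s : Set A)
    (hind : ((Γᶜ).induce s).Connected) :
    (∃ (B : Type) (Λ : SimpleGraph B), Nonempty (ExtCentralizer Γ s ≃* RAAG Λ)) ∧
    ∃ j : RAAG Γ →* ExtCentralizer Γ s,
      (∀ a : A, j (raagGen Γ a) = PresentedGroup.of (some a)) ∧
      ∀ T : Finset (ExtCentralizer Γ s), (∀ x ∈ T, x ≠ 1) →
        ∃ φ : ExtCentralizer Γ s →* RAAG Γ,
          (∀ g : RAAG Γ, φ (j g) = g) ∧ ∀ x ∈ T, φ x ≠ 1 := by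
  refine ⟨⟨_, _, ⟨extEquiv Γ s⟩⟩, extJ Γ s, extJ_gen Γ s, ?_⟩
  classical
  intro T hT
  obtain ⟨φ, h1, h2⟩ := discr_conn Γ s hind (T.image (extEquiv Γ s)) (by
    intro y hy
    obtain ⟨x, hx, rfl⟩ := Finset.mem_image.1 hy
    exact fun h => hT x hx ((extEquiv Γ s).injective (by rw [h, map_one])))
  refine ⟨φ.comp (extEquiv Γ s).toMonoidHom, ?_, ?_⟩
  · intro g
    have : (extFwd Γ s).comp (extJ Γ s) = eI Γ (csG Γ s) := by
      apply r_ext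
      intro a
      rw [MonoidHom.comp_apply, extJ_gen, extFwd_of, eI_gen]
    have h3 : extFwd Γ s (extJ Γ s g) = eI Γ (csG Γ s) g := DFunLike.congr_fun this g
    change φ (extFwd Γ s (extJ Γ s g)) = g
    rw [h3, h1]
  · intro x hx
    exact h2 _ (Finset.mem_image_of_mem _ hx)
end

section
/- Let 𝔾 be a right-angled Artin group, let b ∈ 𝔾 be a cyclically reduced block element, and let w_1, w_2 ∈ 𝔾 be elements with geodesic factorizations w_1 = b^{δ_1} ∘ g_1 ∘ b^{ε} and w_2 = b^{ε} ∘ g_2 ∘ b^{δ_2}, where ε, δ_1, δ_2 ∈ {1, −1} and '∘' denotes that lengths add (|u ∘ v| = |u| + |v|). Then the product w_1 w_2 has a geodesic factorization of the form w_1 w_2 = b^{δ_1} ∘ w_3 ∘ b^{δ_2} for some w_3 ∈ 𝔾. -/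
namespace RaagAux
open Classical

variable {A : Type} {Γ : SimpleGraph A}

def bar (x : A × Bool) : A × Bool := (x.1, !x.2)

theorem bar_bar (x : A × Bool) : bar (bar x) = x := by simp [bar]

theorem bar_fst (x : A × Bool) : (bar x).1 = x.1 := rfl

inductive S (Γ : SimpleGraph A) : List (A × Bool) → List (A × Bool) → Prop
  | refl (l) : S Γ l l
  | cons (a) {l m} : S Γ l m → S Γ (a :: l) (a :: m)
  | swap (a b l) : Γ.Adj a.1 b.1 → S Γ (a :: b :: l) (b :: a :: l)
  | trans {l m k} : S Γ l m → S Γ m k → S Γ l k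

theorem S.symm {l m : List (A × Bool)} (h : S Γ l m) : S Γ m l := by
  induction h with
  | refl l => exact .refl l
  | cons a _ ih => exact .cons a ih
  | swap a b l h => exact .swap b a l h.symm
  | trans _ _ h1 h2 => exact .trans h2 h1

theorem S.perm {l m : List (A × Bool)} (h : S Γ l m) : l.Perm m := by
  induction h with
  | refl l => exact .refl l
  | cons a _ ih => exact .cons a ih
  | swap a b l h => exact .swap b a l
  | trans _ _ h1 h2 => exact .trans h1 h2

noncomputable def del (Γ : SimpleGraph A) (x : A × Bool) :
    List (A × Bool) → Option (List (A × Bool))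
  | [] => none
  | y :: l => if y = x then some l else
      if Γ.Adj x.1 y.1 then (del Γ x l).map (y :: ·) else none

theorem del_self (x : A × Bool) (l) : del Γ x (x :: l) = some l := by simp [del]

theorem del_adj {x y : A × Bool} (h : Γ.Adj x.1 y.1) (l) :
    del Γ x (y :: l) = (del Γ x l).map (y :: ·) := by
  have : y ≠ x := by rintro rfl; exact h.ne rfl
  simp [del, this, h]

theorem del_cons_some {x y : A × Bool} {l m} (h : del Γ x (y :: l) = some m) :
    (y = x ∧ m = l) ∨ (Γ.Adj x.1 y.1 ∧ ∃ k, del Γ x l = some k ∧ m = y :: k) := by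
  rw [del] at h
  split_ifs at h with h1 h2
  · left; exact ⟨h1, by simpa using h.symm⟩
  · right
    refine ⟨h2, ?_⟩
    simp only [Option.map_eq_some_iff] at h
    obtain ⟨k, hk, rfl⟩ := h
    exact ⟨k, hk, rfl⟩

theorem del_S {x : A × Bool} {l m} (h : del Γ x l = some m) : S Γ l (x :: m) := by
  induction l generalizing m with
  | nil => simp [del] at h
  | cons y l ih =>
    rcases del_cons_some h with ⟨rfl, rfl⟩ | ⟨ha, k, hk, rfl⟩
    · exact .refl _
    · exact .trans (.cons y (ih hk)) (.swap _ _ _ ha.symm)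

theorem S.del {l l' : List (A × Bool)} (h : S Γ l l') (x : A × Bool) {m}
    (hm : del Γ x l = some m) : ∃ m', del Γ x l' = some m' ∧ S Γ m m' := by
  induction h generalizing m with
  | refl l => exact ⟨m, hm, .refl _⟩
  | cons a h ih =>
    rcases del_cons_some hm with ⟨rfl, rfl⟩ | ⟨ha, k, hk, rfl⟩
    · exact ⟨_, del_self _ _, h⟩
    · obtain ⟨k', hk', hs⟩ := ih hk
      exact ⟨a :: k', by rw [del_adj ha, hk']; rfl, .cons a hs⟩
  | swap a b l h =>
    rcases del_cons_some hm with ⟨rfl, rfl⟩ | ⟨ha, k, hk, rfl⟩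
    · exact ⟨b :: l, by rw [del_adj h, del_self]; rfl, .refl _⟩
    · rcases del_cons_some hk with ⟨rfl, rfl⟩ | ⟨hb, k', hk', rfl⟩
      · exact ⟨_, del_self _ _, .refl _⟩
      · exact ⟨b :: a :: k', by rw [del_adj hb, del_adj ha, hk']; rfl, .swap _ _ _ h⟩
  | trans _ _ h1 h2 =>
    obtain ⟨m1, e1, s1⟩ := h1 hm
    obtain ⟨m2, e2, s2⟩ := h2 e1
    exact ⟨m2, e2, s1.trans s2⟩

theorem S.del_none {l l' : List (A × Bool)} (h : S Γ l l') {x : A × Bool}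
    (hm : RaagAux.del Γ x l = none) : RaagAux.del Γ x l' = none := by
  by_contra hc
  obtain ⟨m, e⟩ := Option.ne_none_iff_exists'.1 hc
  obtain ⟨m', e', _⟩ := h.symm.del x e
  rw [hm] at e'; cases e'

def Red (Γ : SimpleGraph A) : List (A × Bool) → Prop
  | [] => True
  | x :: l => Red Γ l ∧ del Γ (bar x) l = none

theorem S.red {l l' : List (A × Bool)} (h : S Γ l l') (hr : Red Γ l) : Red Γ l' := by
  induction h with
  | refl l => exact hr
  | cons a h ih => exact ⟨ih hr.1, h.del_none hr.2⟩
  | swap a b l h =>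
    obtain ⟨⟨h1, h2⟩, h3⟩ := hr
    rw [del_adj (by exact h)] at h3
    refine ⟨⟨h1, by simpa using h3⟩, ?_⟩
    rw [del_adj (by exact h.symm), h2]; rfl
  | trans _ _ h1 h2 => exact h2 (h1 hr)

noncomputable def act (Γ : SimpleGraph A) (x : A × Bool) (l : List (A × Bool)) :
    List (A × Bool) :=
  match del Γ (bar x) l with
  | none => x :: l
  | some m => m

theorem act_none {x : A × Bool} {l} (h : del Γ (bar x) l = none) : act Γ x l = x :: l := by
  simp [act, h]

theorem act_some {x : A × Bool} {l m} (h : del Γ (bar x) l = some m) : act Γ x l = m := by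
  simp [act, h]

theorem S.act {l l' : List (A × Bool)} (h : S Γ l l') (x : A × Bool) :
    S Γ (act Γ x l) (act Γ x l') := by
  cases e : RaagAux.del Γ (bar x) l with
  | none => rw [act_none e, act_none (h.del_none e)]; exact .cons x h
  | some m =>
    obtain ⟨m', e', s⟩ := h.del _ e
    rw [act_some e, act_some e']; exact s

theorem red_act {l : List (A × Bool)} (h : Red Γ l) (x : A × Bool) : Red Γ (act Γ x l) := by
  cases e : del Γ (bar x) l with
  | none => rw [act_none e]; exact ⟨h, e⟩
  | some m => rw [act_some e]; exact ((del_S e).red h).1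

theorem act_bar {l : List (A × Bool)} (h : Red Γ l) (x : A × Bool) :
    S Γ (act Γ (bar x) (act Γ x l)) l := by
  cases e : del Γ (bar x) l with
  | none =>
    rw [act_none e, act_some (m := l) (by rw [bar_bar, del_self])]; exact .refl _
  | some m =>
    rw [act_some e, act_none ((del_S e).red h).2]; exact (del_S e).symm

theorem act_comm_aux {l : List (A × Bool)} {x y : A × Bool} (hxy : Γ.Adj x.1 y.1) {m}
    (e : del Γ (bar x) l = some m) (f : del Γ (bar y) l = none) :
    S Γ (act Γ x (act Γ y l)) (act Γ y (act Γ x l)) := by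
  have h2 := (del_S e).del_none f
  rw [del_adj (by exact hxy.symm)] at h2
  rw [act_some e, act_none f, act_none (x := y) (l := m) (by simpa using h2),
    act_some (m := y :: m) (by rw [del_adj (by exact hxy), e]; rfl)]
  exact .refl _

theorem act_comm {l : List (A × Bool)} {x y : A × Bool} (hxy : Γ.Adj x.1 y.1) :
    S Γ (act Γ x (act Γ y l)) (act Γ y (act Γ x l)) := by
  cases e : del Γ (bar x) l with
  | none =>
    cases f : del Γ (bar y) l with
    | none =>
      rw [act_none e, act_none f, act_none (by rw [del_adj (by exact hxy), e]; rfl),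
        act_none (by rw [del_adj (by exact hxy.symm), f]; rfl)]
      exact .swap _ _ _ hxy
    | some k => exact (act_comm_aux hxy.symm f e).symm
  | some m =>
    cases f : del Γ (bar y) l with
    | none => exact act_comm_aux hxy e f
    | some k =>
      obtain ⟨k', e', s⟩ := (del_S e).del _ f
      rcases del_cons_some e' with ⟨h, _⟩ | ⟨_, k'', hk, rfl⟩
      · exact absurd (congrArg Prod.fst h) hxy.ne
      rw [act_some e, act_some f, act_some hk]
      have := s.act x
      rwa [act_some (del_self _ _)] at this

def st (Γ : SimpleGraph A) : Setoid {l : List (A × Bool) // Red Γ l} where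
  r l m := S Γ l.1 m.1
  iseqv := ⟨fun _ => .refl _, fun h => h.symm, fun h k => h.trans k⟩

abbrev Q (Γ : SimpleGraph A) := Quotient (st Γ)

noncomputable def actQ (Γ : SimpleGraph A) (x : A × Bool) : Q Γ → Q Γ :=
  Quotient.map (sa := st Γ) (sb := st Γ) (fun l => ⟨act Γ x l.1, red_act l.2 x⟩)
    (fun _ _ h => S.act h x)

theorem actQ_bar (x : A × Bool) (q : Q Γ) : actQ Γ (bar x) (actQ Γ x q) = q := by
  induction q using Quotient.inductionOn with
  | h l => exact Quotient.sound (s := st Γ) (act_bar l.2 x)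

theorem actQ_comm {x y : A × Bool} (h : Γ.Adj x.1 y.1) (q : Q Γ) :
    actQ Γ x (actQ Γ y q) = actQ Γ y (actQ Γ x q) := by
  induction q using Quotient.inductionOn with
  | h l => exact Quotient.sound (s := st Γ) (act_comm h)

noncomputable def pm (Γ : SimpleGraph A) (a : A) : Equiv.Perm (Q Γ) where
  toFun := actQ Γ (a, true)
  invFun := actQ Γ (a, false)
  left_inv := actQ_bar (a, true)
  right_inv := actQ_bar (a, false)

noncomputable def Phi (Γ : SimpleGraph A) : RAAG Γ →* Equiv.Perm (Q Γ) :=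
  PresentedGroup.toGroup (f := pm Γ) (by
    rintro r ⟨a, b, hab, rfl⟩
    simp only [map_mul, map_inv, FreeGroup.lift_apply_of]
    rw [mul_inv_eq_one, mul_inv_eq_iff_eq_mul]
    ext q
    exact actQ_comm (x := (a, true)) (y := (b, true)) hab q)

def val (Γ : SimpleGraph A) (l : List (A × Bool)) : RAAG Γ := raagMk Γ (FreeGroup.mk l)

theorem val_append (l m : List (A × Bool)) : val Γ (l ++ m) = val Γ l * val Γ m := by
  rw [val, ← FreeGroup.mul_mk, map_mul]; rfl

theorem val_cons (x) (l : List (A × Bool)) : val Γ (x :: l) = val Γ [x] * val Γ l :=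
  val_append [x] l

theorem val_nil : val Γ [] = 1 := map_one (raagMk Γ)

theorem val_inv (l : List (A × Bool)) : (val Γ l)⁻¹ = val Γ (FreeGroup.invRev l) := by
  rw [val, ← map_inv, FreeGroup.inv_mk]; rfl

theorem val_bar (x : A × Bool) : val Γ [bar x] = (val Γ [x])⁻¹ := by
  rw [val_inv]; rfl

theorem val_true (a : A) : val Γ [(a, true)] = PresentedGroup.of a := rfl

theorem val_swap {x y : A × Bool} (h : Γ.Adj x.1 y.1) :
    Commute (val Γ [x]) (val Γ [y]) := by
  have key : ∀ a b : A, Γ.Adj a b → Commute (val Γ [(a, true)]) (val Γ [(b, true)]) := by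
    intro a b hab
    have : raagMk Γ (FreeGroup.of a * FreeGroup.of b * (FreeGroup.of a)⁻¹ *
        (FreeGroup.of b)⁻¹) = 1 :=
      (PresentedGroup.one_of_mem (rels := raagRels Γ) ⟨a, b, hab, rfl⟩)
    simp only [map_mul, map_inv] at this
    rw [mul_inv_eq_one, mul_inv_eq_iff_eq_mul] at this
    exact this
  obtain ⟨a, s⟩ := x
  obtain ⟨b, t⟩ := y
  have k := key a b h
  have ea : val Γ [(a, false)] = (val Γ [(a, true)])⁻¹ := val_bar (a, true)
  have eb : val Γ [(b, false)] = (val Γ [(b, true)])⁻¹ := val_bar (b, true)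
  cases s <;> cases t <;> (try rw [ea]) <;> (try rw [eb])
  · exact k.inv_inv
  · exact k.inv_left
  · exact k.inv_right
  · exact k

theorem S.val {l m : List (A × Bool)} (h : S Γ l m) : val Γ l = val Γ m := by
  induction h with
  | refl l => rfl
  | cons a h ih => rw [val_cons, ih, ← val_cons]
  | swap a b l h =>
    rw [val_cons a (b :: l), val_cons b l, val_cons b (a :: l), val_cons a l, ← mul_assoc,
      ← mul_assoc, (val_swap h).eq]
  | trans _ _ h1 h2 => exact h1.trans h2

theorem Phi_letter (x : A × Bool) (q : Q Γ) : Phi Γ (val Γ [x]) q = actQ Γ x q := by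
  have k : ∀ a, Phi Γ (val Γ [(a, true)]) = pm Γ a := fun a => by
    rw [val_true, Phi, PresentedGroup.toGroup.of]
  obtain ⟨a, s⟩ := x
  cases s
  · have ea : val Γ [(a, false)] = (val Γ [(a, true)])⁻¹ := val_bar (a, true)
    rw [ea, map_inv, k]; rfl
  · rw [k]; rfl

theorem Phi_red (l : List (A × Bool)) (h : Red Γ l) :
    Phi Γ (val Γ l) (Quotient.mk (st Γ) ⟨[], trivial⟩) = Quotient.mk (st Γ) ⟨l, h⟩ := by
  induction l with
  | nil => rw [val_nil, map_one]; rfl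
  | cons x l ih =>
    rw [val_cons, map_mul, Equiv.Perm.mul_apply, ih h.1, Phi_letter]
    apply Quotient.sound (s := st Γ)
    show S Γ (act Γ x l) (x :: l)
    rw [act_none h.2]; exact .refl _

theorem red_unique {l m : List (A × Bool)} (hl : Red Γ l) (hm : Red Γ m)
    (h : val Γ l = val Γ m) : S Γ l m := by
  have h1 := Phi_red l hl
  rw [h, Phi_red m hm] at h1
  exact (Quotient.exact (s := st Γ) h1).symm

theorem not_red {l : List (A × Bool)} (h : ¬ Red Γ l) :
    ∃ m : List (A × Bool), m.length < l.length ∧ val Γ m = val Γ l := by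
  induction l with
  | nil => exact absurd trivial h
  | cons x l ih =>
    by_cases hl : Red Γ l
    · have : del Γ (bar x) l ≠ none := fun e => h ⟨hl, e⟩
      obtain ⟨m, e⟩ := Option.ne_none_iff_exists'.1 this
      have s := del_S e
      refine ⟨m, ?_, ?_⟩
      · have := s.perm.length_eq
        simp at this ⊢; omega
      · rw [val_cons, s.val, val_cons (bar x), val_bar]; group
    · obtain ⟨m, h1, h2⟩ := ih hl
      exact ⟨x :: m, by simpa using h1, by rw [val_cons, h2, ← val_cons]⟩

theorem len_le (l : List (A × Bool)) : raagLen Γ (val Γ l) ≤ l.length :=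
  Nat.sInf_le ⟨l, rfl, rfl⟩

theorem exists_word (g : RAAG Γ) : ∃ l, val Γ l = g ∧ l.length = raagLen Γ g := by
  have : {m | ∃ l : List (A × Bool), l.length = m ∧ raagMk Γ (FreeGroup.mk l) = g}.Nonempty := by
    obtain ⟨w, hw⟩ := PresentedGroup.mk_surjective (raagRels Γ) g
    exact ⟨_, w.toWord, rfl, by rw [FreeGroup.mk_toWord]; exact hw⟩
  obtain ⟨l, h1, h2⟩ := Nat.sInf_mem this
  exact ⟨l, h2, h1⟩

theorem red_of_len {l : List (A × Bool)} (h : l.length ≤ raagLen Γ (val Γ l)) : Red Γ l := by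
  by_contra hc
  obtain ⟨m, h1, h2⟩ := not_red hc
  have := len_le (Γ := Γ) m
  rw [h2] at this; omega

theorem len_red {l : List (A × Bool)} (h : Red Γ l) : raagLen Γ (val Γ l) = l.length := by
  obtain ⟨m, h1, h2⟩ := exists_word (val Γ l)
  have hm : Red Γ m := red_of_len (by rw [h1, h2])
  rw [← h2, (red_unique hm h h1).perm.length_eq]

theorem exists_red (g : RAAG Γ) : ∃ l, val Γ l = g ∧ Red Γ l := by
  obtain ⟨l, h1, h2⟩ := exists_word g
  exact ⟨l, h1, red_of_len (by rw [h1, h2])⟩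

theorem len_mul (g h : RAAG Γ) : raagLen Γ (g * h) ≤ raagLen Γ g + raagLen Γ h := by
  obtain ⟨l, rfl, h2⟩ := exists_word g
  obtain ⟨m, rfl, h4⟩ := exists_word h
  rw [← val_append, ← h2, ← h4, ← List.length_append]; exact len_le _

theorem len_inv (g : RAAG Γ) : raagLen Γ g⁻¹ = raagLen Γ g := by
  have k : ∀ g : RAAG Γ, raagLen Γ g⁻¹ ≤ raagLen Γ g := by
    intro g
    obtain ⟨l, rfl, h2⟩ := exists_word g
    rw [← h2, val_inv]
    exact (len_le _).trans (by simp)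
  apply le_antisymm (k g)
  simpa using k g⁻¹

/-- `y` is a left divisor of `g`. -/
def D (Γ : SimpleGraph A) (y : A × Bool) (g : RAAG Γ) : Prop :=
  ∃ g', g = val Γ [y] * g' ∧ raagLen Γ g = raagLen Γ g' + 1

theorem D_of_del {y : A × Bool} {l m} (hl : Red Γ l) (h : del Γ y l = some m) :
    D Γ y (val Γ l) := by
  have s := del_S h
  refine ⟨val Γ m, by rw [s.val, val_cons], ?_⟩
  rw [len_red hl, len_red (s.red hl).1, s.perm.length_eq]; rfl

theorem D_del {y : A × Bool} {l} (hl : Red Γ l) (h : D Γ y (val Γ l)) :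
    ∃ m, del Γ y l = some m := by
  obtain ⟨g', h1, h2⟩ := h
  obtain ⟨m, rfl, hm⟩ := exists_word g'
  rw [← val_cons] at h1
  have hr : Red Γ (y :: m) := red_of_len (by rw [← h1, h2, ← hm]; rfl)
  obtain ⟨k, hk, _⟩ := (red_unique hr hl h1.symm).del y (del_self y m)
  exact ⟨k, hk⟩

theorem del_mem {y : A × Bool} {l m} (h : del Γ y l = some m) : y ∈ l :=
  (del_S h).perm.mem_iff.2 (by simp)

theorem del_append {y : A × Bool} {l m k} (h : del Γ y (l ++ m) = some k) :
    (∃ k', del Γ y l = some k') ∨ ((∀ z ∈ l, Γ.Adj y.1 z.1) ∧ ∃ k', del Γ y m = some k') := by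
  induction l generalizing k with
  | nil => right; exact ⟨by simp, k, h⟩
  | cons x l ih =>
    rcases del_cons_some h with ⟨rfl, _⟩ | ⟨ha, k', hk, rfl⟩
    · left; exact ⟨l, del_self _ _⟩
    · rcases ih hk with ⟨k2, h2⟩ | ⟨h1, h2⟩
      · left; exact ⟨x :: k2, by rw [del_adj ha, h2]; rfl⟩
      · right; exact ⟨List.forall_mem_cons.2 ⟨ha, h1⟩, h2⟩

theorem commute_word {y : A × Bool} {l : List (A × Bool)} (h : ∀ z ∈ l, Γ.Adj y.1 z.1) :
    Commute (val Γ [y]) (val Γ l) := by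
  induction l with
  | nil => rw [val_nil]; exact Commute.one_right _
  | cons x l ih =>
    rw [val_cons]
    exact (val_swap (h x (by simp))).mul_right (ih fun z hz => h z (by simp [hz]))

theorem red_inv {l : List (A × Bool)} (h : Red Γ l) : Red Γ (FreeGroup.invRev l) := by
  apply red_of_len
  rw [← val_inv, len_inv, len_red h]; simp

theorem L2 {y : A × Bool} {u v : RAAG Γ} (hl : raagLen Γ (u * v) = raagLen Γ u + raagLen Γ v)
    (h : D Γ y (u * v)) :
    D Γ y u ∨ (Commute (val Γ [y]) u ∧ D Γ y v ∧ ¬ D Γ y u ∧ ¬ D Γ y u⁻¹) := by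
  obtain ⟨l, rfl, h1⟩ := exists_red u
  obtain ⟨m, rfl, h2⟩ := exists_red v
  rw [← val_append, len_red h1, len_red h2] at hl
  rw [← val_append] at h
  have hr : Red Γ (l ++ m) := red_of_len (by rw [hl]; simp)
  obtain ⟨k, hk⟩ := D_del hr h
  rcases del_append hk with ⟨k', hk'⟩ | ⟨hc, k', hk'⟩
  · left; exact D_of_del h1 hk'
  · right
    refine ⟨commute_word hc, D_of_del h2 hk', ?_, ?_⟩
    · intro hd
      obtain ⟨k2, e⟩ := D_del h1 hd
      exact (hc _ (del_mem e)).ne rfl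
    · intro hd
      rw [val_inv] at hd
      obtain ⟨k2, e⟩ := D_del (red_inv h1) hd
      have := del_mem e
      simp only [FreeGroup.invRev, List.mem_reverse, List.mem_map] at this
      obtain ⟨z, hz, hzy⟩ := this
      exact (hc _ hz).ne (by rw [← hzy])

theorem L1w {l m : List (A × Bool)} (hl : Red Γ l) (hm : Red Γ m) (h : ¬ Red Γ (l ++ m)) :
    ∃ y, D Γ y (val Γ l)⁻¹ ∧ D Γ y (val Γ m) := by
  induction l with
  | nil => exact absurd hm h
  | cons a l ih =>
    by_cases hlm : Red Γ (l ++ m)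
    · have : del Γ (bar a) (l ++ m) ≠ none := fun e => h ⟨hlm, e⟩
      obtain ⟨k, e⟩ := Option.ne_none_iff_exists'.1 this
      rcases del_append e with ⟨k', hk'⟩ | ⟨hc, k', hk'⟩
      · rw [hl.2] at hk'; cases hk'
      · refine ⟨bar a, ⟨(val Γ l)⁻¹, ?_, ?_⟩, D_of_del hm hk'⟩
        · rw [val_cons, mul_inv_rev, val_bar]
          have := commute_word (Γ := Γ) (y := a) hc
          exact this.inv_inv.eq.symm
        · rw [len_inv, len_inv, len_red hl, len_red hl.1]; rfl
    · obtain ⟨y, ⟨g', e1, e2⟩, h2⟩ := ih hl.1 hlm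
      refine ⟨y, ⟨g' * (val Γ [a])⁻¹, by rw [val_cons, mul_inv_rev, e1, mul_assoc], ?_⟩, h2⟩
      have e3 : (val Γ (a :: l))⁻¹ = val Γ [y] * (g' * (val Γ [a])⁻¹) := by
        rw [val_cons, mul_inv_rev, e1, mul_assoc]
      have i1 := len_mul (val Γ [y]) (g' * (val Γ [a])⁻¹)
      have i2 := len_mul g' (val Γ [a])⁻¹
      have i3 := len_le (Γ := Γ) [a]
      have i4 := len_le (Γ := Γ) [y]
      rw [← e3] at i1
      rw [len_inv] at i1 i2 e2 ⊢
      rw [len_red hl] at i1 ⊢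
      rw [len_red hl.1] at e2
      simp only [List.length_cons, List.length_nil] at *
      omega

theorem L1 {u v : RAAG Γ} (h : raagLen Γ (u * v) ≠ raagLen Γ u + raagLen Γ v) :
    ∃ y, D Γ y u⁻¹ ∧ D Γ y v := by
  obtain ⟨l, rfl, h1⟩ := exists_red u
  obtain ⟨m, rfl, h2⟩ := exists_red v
  apply L1w h1 h2
  intro hr
  apply h
  rw [← val_append, len_red h1, len_red h2, len_red hr, List.length_append]

theorem main {c d₁ d₂ : RAAG Γ} (hc : raagLen Γ (c * c) = 2 * raagLen Γ c)
    (hd₁ : d₁ = c ∨ d₁ = c⁻¹) (hd₂ : d₂ = c ∨ d₂ = c⁻¹) (n : ℕ) : ∀ (h₁ h₂ : RAAG Γ),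
    raagLen Γ h₁ = n →
    raagLen Γ (c⁻¹ * (h₁ * d₁)) = raagLen Γ c + raagLen Γ h₁ + raagLen Γ d₁ →
    raagLen Γ (c * (h₂ * d₂)) = raagLen Γ c + raagLen Γ h₂ + raagLen Γ d₂ →
    ∃ w : RAAG Γ, (c⁻¹ * (h₁ * d₁))⁻¹ * (c * (h₂ * d₂)) = d₁⁻¹ * w * d₂ ∧
      raagLen Γ (d₁⁻¹ * w * d₂) = raagLen Γ d₁ + raagLen Γ w + raagLen Γ d₂ := by
  induction n with
  | zero => ?_
  | succ n ih => ?_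
  all_goals
    intro h₁ h₂ hn e₁ e₂
    by_cases hadd : raagLen Γ ((c⁻¹ * (h₁ * d₁))⁻¹ * (c * (h₂ * d₂))) =
        raagLen Γ (c⁻¹ * (h₁ * d₁))⁻¹ + raagLen Γ (c * (h₂ * d₂))
    · have e : (c⁻¹ * (h₁ * d₁))⁻¹ * (c * (h₂ * d₂)) = d₁⁻¹ * (h₁⁻¹ * c * (c * h₂)) * d₂ := by
        group
      refine ⟨h₁⁻¹ * c * (c * h₂), e, ?_⟩
      rw [len_inv, e, e₁, e₂] at hadd
      have i1 := len_mul (d₁⁻¹ * (h₁⁻¹ * c * (c * h₂))) d₂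
      have i2 := len_mul d₁⁻¹ (h₁⁻¹ * c * (c * h₂))
      have i3 := len_mul (h₁⁻¹ * c) (c * h₂)
      have i4 := len_mul h₁⁻¹ c
      have i5 := len_mul c h₂
      rw [len_inv] at i2 i4
      omega
    obtain ⟨y, y1, y2⟩ := L1 hadd
    rw [inv_inv] at y1
    have a1 := len_mul c⁻¹ (h₁ * d₁)
    have a2 := len_mul h₁ d₁
    have a3 := len_mul c (h₂ * d₂)
    have a4 := len_mul h₂ d₂
    have a5 := len_inv c
    have key : Commute (val Γ [y]) c ∧ D Γ y h₁ ∧ D Γ y h₂ := by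
      rcases L2 (by omega) y1 with b1 | ⟨b1, b2, b3, b4⟩
      · exfalso
        rcases L2 (by omega) y2 with c1 | ⟨c1, c2, c3, c4⟩
        · obtain ⟨p, p1, p2⟩ := b1
          obtain ⟨q, q1, q2⟩ := c1
          have : c * c = p⁻¹ * q := by
            have : c = p⁻¹ * (val Γ [y])⁻¹ := by rw [← mul_inv_rev, ← p1, inv_inv]
            nth_rw 1 [this]
            rw [q1]; group
          have i := len_mul p⁻¹ q
          rw [← this, len_inv] at i
          omega
        · exact c4 b1
      · rw [inv_inv] at b4
        rcases L2 (by omega) y2 with c1 | ⟨c1, c2, c3, c4⟩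
        · exact absurd c1 b4
        refine ⟨c1, ?_, ?_⟩
        · rcases L2 (by omega) b2 with r | ⟨_, r, _⟩
          · exact r
          · rcases hd₁ with rfl | rfl
            · exact absurd r c3
            · exact absurd r c4
        · rcases L2 (by omega) c2 with r | ⟨_, r, _⟩
          · exact r
          · rcases hd₂ with rfl | rfl
            · exact absurd r c3
            · exact absurd r c4
    obtain ⟨kc, ⟨p, rfl, p2⟩, ⟨q, rfl, q2⟩⟩ := key
  · omega
  · have f1 : c⁻¹ * (val Γ [y] * p * d₁) = val Γ [y] * (c⁻¹ * (p * d₁)) := by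
      rw [mul_assoc, ← mul_assoc, ← kc.inv_right.eq, mul_assoc]
    have f2 : c * (val Γ [y] * q * d₂) = val Γ [y] * (c * (q * d₂)) := by
      rw [mul_assoc, ← mul_assoc, ← kc.eq, mul_assoc]
    rw [f1] at e₁ ⊢
    rw [f2] at e₂ ⊢
    have g1 := len_mul (val Γ [y]) (c⁻¹ * (p * d₁))
    have g2 := len_mul (val Γ [y]) (c * (q * d₂))
    have g3 := len_le (Γ := Γ) [y]
    simp only [List.length_cons, List.length_nil] at g3
    have k1 := len_mul c⁻¹ (p * d₁)
    have k2 := len_mul p d₁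
    have k3 := len_mul c (q * d₂)
    have k4 := len_mul q d₂
    obtain ⟨w, w1, w2⟩ := ih p q (by omega) (by omega) (by omega)
    refine ⟨w, ?_, w2⟩
    rw [← w1]; group

end RaagAux

/-- Lemma 4.17: if `b` is a cyclically reduced block and
`w₁ = b^{δ₁} ∘ g₁ ∘ b^{ε}`, `w₂ = b^{ε} ∘ g₂ ∘ b^{δ₂}` are geodesic factorizations
(`∘` means lengths add), then `w₁ w₂` has a geodesic factorization of the form
`b^{δ₁} ∘ w₃ ∘ b^{δ₂}`. -/
theorem raag_block_power_normal_form {A : Type} [Fintype A] (Γ : SimpleGraph A)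
    (b : RAAG Γ) (hbc : CyclicallyReduced Γ b) (hbb : IsBlock Γ b)
    (ε δ₁ δ₂ : ℤ)
    (hε : ε = 1 ∨ ε = -1) (hδ₁ : δ₁ = 1 ∨ δ₁ = -1) (hδ₂ : δ₂ = 1 ∨ δ₂ = -1)
    (g₁ g₂ w₁ w₂ : RAAG Γ)
    (hw₁ : w₁ = b ^ δ₁ * g₁ * b ^ ε)
    (hw₁len : raagLen Γ w₁ =
      raagLen Γ (b ^ δ₁) + raagLen Γ g₁ + raagLen Γ (b ^ ε))
    (hw₂ : w₂ = b ^ ε * g₂ * b ^ δ₂)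
    (hw₂len : raagLen Γ w₂ =
      raagLen Γ (b ^ ε) + raagLen Γ g₂ + raagLen Γ (b ^ δ₂)) :
    ∃ w₃ : RAAG Γ, w₁ * w₂ = b ^ δ₁ * w₃ * b ^ δ₂ ∧
      raagLen Γ (w₁ * w₂) =
        raagLen Γ (b ^ δ₁) + raagLen Γ w₃ + raagLen Γ (b ^ δ₂) := by
  have hcε : b ^ ε = b ∨ b ^ ε = b⁻¹ := by
    rcases hε with rfl | rfl <;> simp
  have hd : ∀ δ : ℤ, (δ = 1 ∨ δ = -1) → (b ^ δ = b ^ ε ∨ b ^ δ = (b ^ ε)⁻¹) := by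
    rintro δ (rfl | rfl) <;> rcases hε with rfl | rfl <;> simp
  have hc : raagLen Γ (b ^ ε * b ^ ε) = 2 * raagLen Γ (b ^ ε) := by
    rcases hcε with h | h <;> rw [h]
    · exact hbc
    · rw [← mul_inv_rev, RaagAux.len_inv, RaagAux.len_inv]; exact hbc
  have hd1 : (b ^ δ₁)⁻¹ = b ^ ε ∨ (b ^ δ₁)⁻¹ = (b ^ ε)⁻¹ := by
    rcases hd δ₁ hδ₁ with h | h <;> rw [h] <;> simp
  have E1 : ((b ^ ε)⁻¹ * (g₁⁻¹ * (b ^ δ₁)⁻¹)) = w₁⁻¹ := by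
    rw [hw₁]; simp only [mul_inv_rev]
  have E2 : b ^ ε * (g₂ * b ^ δ₂) = w₂ := by rw [hw₂, mul_assoc]
  obtain ⟨w, h1, h2⟩ := RaagAux.main hc hd1 (hd δ₂ hδ₂) _ g₁⁻¹ g₂ rfl
    (by rw [E1, RaagAux.len_inv, RaagAux.len_inv, RaagAux.len_inv, hw₁len]; omega)
    (by rw [E2, hw₂len])
  rw [E1, E2, inv_inv, inv_inv] at h1
  rw [inv_inv, RaagAux.len_inv] at h2
  exact ⟨w, h1, by rw [h1, h2]⟩
end

section
/- (Vaught's conjecture for RAAGs) Let 𝔾 be a right-angled Artin group. If elements x, y, z ∈ 𝔾 satisfy x² y² z² = 1, then x, y, and z pairwise commute. -/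
namespace RaagV
open FreeGroup (IsCyclicallyReduced reduceCyclically)
set_option linter.unusedSectionVars false
set_option linter.unusedSimpArgs false

section Act
variable {P X : Type*} [Group P] [MulAction P X]

def fAct : P →* MulAut (FreeGroup X) where
  toFun p := FreeGroup.freeGroupCongr (MulAction.toPerm p)
  map_one' := by
    ext a
    induction a using FreeGroup.induction_on <;> simp_all
  map_mul' p q := by
    ext a
    induction a using FreeGroup.induction_on <;> simp_all [mul_smul]

def lm (p : P) (L : List (X × Bool)) : List (X × Bool) := L.map fun x => (p • x.1, x.2)

theorem fAct_mk (p : P) (L : List (X × Bool)) : fAct p (FreeGroup.mk L) = FreeGroup.mk (lm p L) :=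
  rfl

theorem fAct_of (p : P) (x : X) : fAct p (FreeGroup.of x) = FreeGroup.of (p • x) := by
  simp [fAct]

theorem fAct_mul (p q : P) (a : FreeGroup X) : fAct (p * q) a = fAct p (fAct q a) := by
  rw [map_mul]; rfl

theorem fAct_inv_self (p : P) (a : FreeGroup X) : fAct p⁻¹ (fAct p a) = a := by
  rw [← fAct_mul]; simp

theorem fAct_self_inv (p : P) (a : FreeGroup X) : fAct p (fAct p⁻¹ a) = a := by
  rw [← fAct_mul]; simp

theorem fAct_inv (p : P) (a : FreeGroup X) : fAct p a⁻¹ = (fAct p a)⁻¹ := map_inv _ _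

theorem fAct_comm {p q : P} (h : Commute p q) (a : FreeGroup X) :
    fAct p (fAct q a) = fAct q (fAct p a) := by
  rw [← fAct_mul, ← fAct_mul, h.eq]

variable [DecidableEq X]

theorem toWord_fAct (p : P) (a : FreeGroup X) : (fAct p a).toWord = lm p a.toWord := by
  have h : FreeGroup.IsReduced (lm p a.toWord) := by
    have := FreeGroup.isReduced_toWord (x := a)
    unfold FreeGroup.IsReduced lm at *
    rw [List.isChain_map]
    simpa using this
  conv_lhs => rw [← FreeGroup.mk_toWord (x := a), fAct_mk, FreeGroup.toWord_mk, h.reduce_eq]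

theorem norm_fAct (p : P) (a : FreeGroup X) : (fAct p a).norm = a.norm := by
  simp [FreeGroup.norm, toWord_fAct, lm]

theorem sq_one {a : FreeGroup X} (h : a ^ 2 = 1) : a = 1 := by
  simpa using h

/-- isolated action -/
def Iso2 (P X : Type*) [Group P] [MulAction P X] : Prop := ∀ (p : P) (x : X), p • p • x = x → p • x = x

theorem map_self {Y : Type*} (f : Y → Y) (L : List Y) (h : L.map f = L) : ∀ x ∈ L, f x = x := by
  induction L with
  | nil => simp
  | cons a L ih => simp only [List.map_cons, List.cons.injEq] at h; simpa [h.1] using ih h.2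

theorem map_self_of {Y : Type*} (f : Y → Y) (L : List Y) (h : ∀ x ∈ L, f x = x) : L.map f = L := by
  induction L with
  | nil => simp
  | cons a L ih => simp_all

theorem fix_of_sq (hI : Iso2 P X) (p : P) (a : FreeGroup X) (h : fAct p (fAct p a) = a) :
    fAct p a = a := by
  apply FreeGroup.toWord_injective
  have h' := congrArg FreeGroup.toWord h
  rw [toWord_fAct, toWord_fAct] at h'
  rw [toWord_fAct]
  unfold lm at *
  rw [List.map_map] at h'
  have := map_self _ _ h'
  refine map_self_of _ _ ?_
  intro x hx
  have h2 := this x hx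
  simp only [Function.comp, Prod.ext_iff] at h2
  exact Prod.ext (hI _ _ h2.1) rfl

theorem one_of_inv (hI : Iso2 P X) (p : P) (a : FreeGroup X) (h : fAct p a = a⁻¹) : a = 1 := by
  have h1 : fAct p a = a := fix_of_sq hI p a (by rw [h, map_inv, h, inv_inv])
  apply sq_one
  rw [pow_two]
  nth_rewrite 2 [← h1]
  rw [h, mul_inv_cancel]

def J (A B : List (X × Bool)) : Prop :=
  ∀ x ∈ A.getLast?, ∀ y ∈ B.head?, x.1 = y.1 → x.2 = y.2

theorem red_app {A B : List (X × Bool)} (hA : FreeGroup.IsReduced A) (hB : FreeGroup.IsReduced B) (h : J A B) :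
    FreeGroup.IsReduced (A ++ B) := List.isChain_append.2 ⟨hA, hB, h⟩

theorem J_left {A B C : List (X × Bool)} (hB : B ≠ []) (h : J B C) : J (A ++ B) C := by
  intro x hx y hy
  rw [List.getLast?_append_of_ne_nil _ hB] at hx
  exact h x hx y hy

theorem J_right {A B C : List (X × Bool)} (hB : B ≠ []) (h : J A B) : J A (B ++ C) := by
  intro x hx y hy
  rw [List.head?_append_of_ne_nil _ hB] at hy
  exact h x hx y hy

theorem not_J {a b : FreeGroup X} (h : ¬ J a.toWord b.toWord) :
    ∃ a' b' u : FreeGroup X, a = a' * u ∧ b = u⁻¹ * b' ∧ a'.norm + 1 ≤ a.norm ∧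
      b'.norm + 1 ≤ b.norm ∧ u.norm ≤ 1 := by
  unfold J at h
  push Not at h
  obtain ⟨x, hx, y, hy, h1, h2⟩ := h
  obtain ⟨A, hA⟩ := List.getLast?_eq_some_iff.1 hx
  obtain ⟨B, hB⟩ := List.head?_eq_some_iff.1 hy
  refine ⟨FreeGroup.mk A, FreeGroup.mk B, FreeGroup.mk [x], ?_, ?_, ?_, ?_, FreeGroup.norm_mk_le⟩
  · rw [FreeGroup.mul_mk, ← hA, FreeGroup.mk_toWord]
  · rw [FreeGroup.inv_mk, FreeGroup.mul_mk]
    have : FreeGroup.invRev [x] ++ B = y :: B := by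
      obtain ⟨x1, x2⟩ := x
      obtain ⟨y1, y2⟩ := y
      simp only [FreeGroup.invRev] at *
      subst h1
      cases x2 <;> cases y2 <;> simp_all
    rw [this, ← hB, FreeGroup.mk_toWord]
  · have := FreeGroup.norm_mk_le (L₁ := A)
    unfold FreeGroup.norm at *
    rw [hA]; simp; exact this
  · have := FreeGroup.norm_mk_le (L₁ := B)
    unfold FreeGroup.norm at *
    rw [hB]; simp; exact this

/-- If the word of `d^2` is cyclically reduced it is a doubled word. -/
theorem sq_word (d : FreeGroup X) (W : List (X × Bool)) (hW : IsCyclicallyReduced W)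
    (h : FreeGroup.mk W = d ^ 2) : ∃ D, W = D ++ D := by
  have h1 : W = (d ^ 2).toWord := by
    rw [← h, FreeGroup.toWord_mk, hW.isReduced.reduce_eq]
  rw [FreeGroup.toWord_pow,
    FreeGroup.reduceCyclically.reduce_flatten_replicate_succ FreeGroup.isReduced_toWord 1] at h1
  set K := FreeGroup.reduceCyclically.conjugator d.toWord
  set R := reduceCyclically d.toWord
  rcases hK : K with _ | ⟨k, K'⟩
  · refine ⟨R, ?_⟩
    rw [h1, hK]; simp [List.replicate]
  · exfalso
    have := hW.2 (k.1, !k.2) (by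
      rw [h1, hK]
      have : FreeGroup.invRev (k :: K') = FreeGroup.invRev K' ++ [(k.1, !k.2)] := by
        simp [FreeGroup.invRev]
      rw [this, ← List.append_assoc, List.getLast?_concat]; rfl) k (by rw [h1, hK]; simp)
    simp at this

def wk (α γ : P) (a b c : FreeGroup X) : FreeGroup X :=
  a * b * c * (fAct α a)⁻¹ * (fAct (γ * α) b)⁻¹ * (fAct γ c)⁻¹

theorem finish (hI : Iso2 P X) (α γ : P) (a b c d : FreeGroup X) (h : wk α γ a b c = d ^ 2)
    (hW : IsCyclicallyReduced (a.toWord ++ b.toWord ++ c.toWord ++ (fAct α a)⁻¹.toWord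
      ++ (fAct (γ * α) b)⁻¹.toWord ++ (fAct γ c)⁻¹.toWord)) : d = 1 := by
  have hm : FreeGroup.mk (a.toWord ++ b.toWord ++ c.toWord ++ (fAct α a)⁻¹.toWord
      ++ (fAct (γ * α) b)⁻¹.toWord ++ (fAct γ c)⁻¹.toWord) = d ^ 2 := by
    rw [← h]; unfold wk
    simp only [← FreeGroup.mul_mk, FreeGroup.mk_toWord]
  obtain ⟨D, hD⟩ := sq_word d _ hW hm
  have la : (fAct α a)⁻¹.toWord.length = a.toWord.length := by
    rw [FreeGroup.toWord_inv, FreeGroup.invRev_length, toWord_fAct, lm, List.length_map]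
  have lb : (fAct (γ * α) b)⁻¹.toWord.length = b.toWord.length := by
    rw [FreeGroup.toWord_inv, FreeGroup.invRev_length, toWord_fAct, lm, List.length_map]
  have lc : (fAct γ c)⁻¹.toWord.length = c.toWord.length := by
    rw [FreeGroup.toWord_inv, FreeGroup.invRev_length, toWord_fAct, lm, List.length_map]
  have hl := congrArg List.length hD
  simp only [List.length_append, la, lb, lc] at hl
  have hD' : (a.toWord ++ b.toWord ++ c.toWord) ++ ((fAct α a)⁻¹.toWord
      ++ (fAct (γ * α) b)⁻¹.toWord ++ (fAct γ c)⁻¹.toWord) = D ++ D := by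
    rw [← hD]; simp
  obtain ⟨e1, e2⟩ := List.append_inj hD' (by simp only [List.length_append]; omega)
  rw [← e2] at e1
  obtain ⟨e3, ec⟩ := List.append_inj e1 (by simp only [List.length_append]; omega)
  obtain ⟨ea, eb⟩ := List.append_inj e3 (by omega)
  rw [FreeGroup.toWord_inj] at ea eb ec
  have ha := one_of_inv hI α a (by rw [← inv_inj, ← ea, inv_inv])
  have hb := one_of_inv hI _ b (by rw [← inv_inj, ← eb, inv_inv])
  have hc := one_of_inv hI γ c (by rw [← inv_inj, ← ec, inv_inv])
  apply sq_one
  rw [← h, ha, hb, hc]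
  simp [wk]

theorem wk_rot {α γ : P} (hc : Commute α γ) (a b c : FreeGroup X) :
    wk (γ * α) α⁻¹ b c (fAct α a)⁻¹ = a⁻¹ * wk α γ a b c * (a⁻¹)⁻¹ := by
  have : α⁻¹ * (γ * α) = γ := by rw [← hc.eq]; group
  unfold wk
  rw [this]
  simp only [fAct_inv, fAct_inv_self]
  group

theorem rot_comm {α γ : P} (hc : Commute α γ) : Commute (γ * α) α⁻¹ :=
  (hc.symm.mul_left (Commute.refl α)).inv_right

/-- solved for smaller size -/
def Claim (P X : Type*) [Group P] [MulAction P X] [DecidableEq X] (n : ℕ) : Prop :=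
  ∀ (α γ : P) (a b c d : FreeGroup X), Commute α γ →
  a.norm + b.norm + c.norm < n → wk α γ a b c = d ^ 2 → d = 1

theorem corner {n : ℕ} (H : Claim P X n) {α γ : P} {a b c d : FreeGroup X} (hc : Commute α γ)
    (hn : a.norm + b.norm + c.norm ≤ n) (h : wk α γ a b c = d ^ 2) (hd : d ≠ 1) :
    J a.toWord b.toWord := by
  by_contra hJ
  obtain ⟨a', b', u, rfl, rfl, h1, h2, h3⟩ := not_J hJ
  apply hd
  refine H α γ a' b' (c * (fAct α u)⁻¹) d hc ?_ ?_
  · have := FreeGroup.norm_mul_le c (fAct α u)⁻¹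
    rw [FreeGroup.norm_inv_eq, norm_fAct] at this
    omega
  · rw [← h]; unfold wk
    simp only [map_mul, map_inv, fAct_mul, MulAut.mul_apply]
    group

theorem corner' {n : ℕ} (H : Claim P X n) {α γ : P} {a b d : FreeGroup X} (hc : Commute α γ)
    (hn : a.norm + b.norm ≤ n) (h : wk α γ a b 1 = d ^ 2) (hd : d ≠ 1) :
    J b.toWord (fAct α a)⁻¹.toWord := by
  by_contra hJ
  obtain ⟨b', k, u, rfl, h0, h1, h2, h3⟩ := not_J hJ
  apply hd
  have ha : a = (fAct α⁻¹ k)⁻¹ * fAct α⁻¹ u := by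
    rw [inv_eq_iff_eq_inv] at h0
    rw [← fAct_inv_self α a, h0]
    simp
  rw [FreeGroup.norm_inv_eq, norm_fAct] at h2
  subst ha
  refine H α (γ * α) (fAct α⁻¹ k)⁻¹ (fAct α⁻¹ u) b' d (hc.mul_right (Commute.refl _)) ?_ ?_
  · rw [FreeGroup.norm_inv_eq, norm_fAct, norm_fAct]
    omega
  · rw [← h]; unfold wk
    simp only [map_mul, map_inv, fAct_mul, MulAut.mul_apply, ]
    simp only [← MulAut.mul_apply, ← map_mul, ← fAct_mul]
    simp [mul_assoc]

theorem single (hI : Iso2 P X) (α : P) (n : ℕ) : ∀ (a d : FreeGroup X), a.norm < n →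
    a * (fAct α a)⁻¹ = d ^ 2 → d = 1 := by
  induction n with
  | zero => intro a d h; omega
  | succ n ih =>
    intro a d hn h
    by_contra hd
    have key : ∀ b : FreeGroup X, fAct α b = b → True := fun _ _ => trivial
    by_cases ha : a = 1
    · subst ha
      apply hd; apply sq_one; rw [← h]; simp
    have hA : a.toWord ≠ [] := by simpa using ha
    have hA' : (fAct α a)⁻¹.toWord ≠ [] := by
      rw [Ne, FreeGroup.toWord_eq_nil_iff, inv_eq_one, map_eq_one_iff _ (MulEquiv.injective _)]
      exact ha
    have J1 : J a.toWord (fAct α a)⁻¹.toWord := by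
      intro x hx y hy
      rw [FreeGroup.toWord_inv, toWord_fAct] at hy
      obtain ⟨A, hA⟩ := List.getLast?_eq_some_iff.1 hx
      have hy' : y = (α • x.1, !x.2) := by
        rw [hA] at hy
        simpa [FreeGroup.invRev, lm, eq_comm] using hy
      intro e
      exfalso
      apply hd
      apply ih (FreeGroup.mk A) d
      · have := FreeGroup.norm_mk_le (L₁ := A)
        unfold FreeGroup.norm at *
        rw [hA] at hn; simp at hn; omega
      · rw [← h, ← FreeGroup.mk_toWord (x := a), hA, ← FreeGroup.mul_mk, map_mul]
        have : fAct α (FreeGroup.mk [x]) = FreeGroup.mk [x] := by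
          rw [fAct_mk]; rw [hy'] at e; simp only at e
          simp [lm, ← e]
        rw [this]; group
    have J2 : J (fAct α a)⁻¹.toWord a.toWord := by
      intro y hy x hx
      rw [FreeGroup.toWord_inv, toWord_fAct] at hy
      obtain ⟨A, hA⟩ := List.head?_eq_some_iff.1 hx
      have hy' : y = (α • x.1, !x.2) := by
        rw [hA] at hy
        simpa [FreeGroup.invRev, lm, eq_comm] using hy
      intro e
      exfalso
      apply hd
      have hxx : fAct α (FreeGroup.mk [x]) = FreeGroup.mk [x] := by
          rw [fAct_mk]; rw [hy'] at e; simp only at e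
          simp [lm, e]
      have hax : a = FreeGroup.mk [x] * FreeGroup.mk A := by
        rw [FreeGroup.mul_mk, ← FreeGroup.mk_toWord (x := a), hA]; rfl
      have := ih (FreeGroup.mk A) ((FreeGroup.mk [x])⁻¹ * d * (FreeGroup.mk [x])) ?_ ?_
      · have h3 : d = FreeGroup.mk [x] * 1 * (FreeGroup.mk [x])⁻¹ := by rw [← this]; group
        rw [h3]; group
      · have := FreeGroup.norm_mk_le (L₁ := A)
        unfold FreeGroup.norm at *
        rw [hA] at hn; simp at hn; omega
      · have : ((FreeGroup.mk [x])⁻¹ * d * (FreeGroup.mk [x])) ^ 2 =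
          (FreeGroup.mk [x])⁻¹ * d ^ 2 * (FreeGroup.mk [x]) := by simp only [pow_two]; group
        rw [this, ← h, hax, map_mul, hxx]
        group
    apply hd
    refine finish hI α 1 a 1 1 d ?_ ?_
    · rw [← h]; simp [wk]
    · simp only [map_one, inv_one, FreeGroup.toWord_one, List.append_nil]
      exact ⟨red_app FreeGroup.isReduced_toWord FreeGroup.isReduced_toWord J1,
        J_left hA' (J_right hA J2)⟩

theorem conj_sq {G : Type*} [Group G] (a d : G) : (a * d * a⁻¹) ^ 2 = a * d ^ 2 * a⁻¹ := by
  simp only [pow_two]; group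

theorem conj_one {G : Type*} [Group G] {a d : G} : a * d * a⁻¹ = 1 ↔ d = 1 := by
  simp

theorem claim_two (hI : Iso2 P X) {n : ℕ} (H : Claim P X n) {α γ : P} {a b d : FreeGroup X}
    (hc : Commute α γ) (hn : a.norm + b.norm ≤ n) (h : wk α γ a b 1 = d ^ 2) : d = 1 := by
  by_contra hd
  by_cases ha : a = 1
  · subst ha
    exact hd (single hI (γ * α) _ b d (Nat.lt_succ_self _) (by rw [← h]; simp [wk]))
  by_cases hb : b = 1
  · subst hb
    exact hd (single hI α _ a d (Nat.lt_succ_self _) (by rw [← h]; simp [wk]))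
  have hc2 : Commute α⁻¹ γ⁻¹ := hc.inv_inv
  have h2 : wk α⁻¹ γ⁻¹ (fAct α a)⁻¹ (fAct (γ * α) b)⁻¹ 1 = ((a * b)⁻¹ * d * ((a * b)⁻¹)⁻¹) ^ 2 := by
    rw [conj_sq, ← h]
    have : γ⁻¹ * α⁻¹ = (γ * α)⁻¹ := by rw [mul_inv_rev, hc2.eq]
    unfold wk
    rw [this]
    simp only [fAct_inv, fAct_inv_self, map_one]
    group
  have hd2 : (a * b)⁻¹ * d * ((a * b)⁻¹)⁻¹ ≠ 1 := by rwa [Ne, conj_one]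
  have hn2 : (fAct α a)⁻¹.norm + (fAct (γ * α) b)⁻¹.norm ≤ n := by
    simpa only [FreeGroup.norm_inv_eq, norm_fAct] using hn
  have J1 : J a.toWord b.toWord := corner H hc (by simpa using hn) h hd
  have J2 := corner' H hc hn h hd
  have J3 := corner H hc2 (by simpa using hn2) h2 hd2
  have J4 := corner' H hc2 hn2 h2 hd2
  rw [map_inv, fAct_inv_self, inv_inv] at J4
  have hA : a.toWord ≠ [] := by simpa using ha
  have hB : b.toWord ≠ [] := by simpa using hb
  have hA' : (fAct α a)⁻¹.toWord ≠ [] := by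
      rw [Ne, FreeGroup.toWord_eq_nil_iff, inv_eq_one, map_eq_one_iff _ (MulEquiv.injective _)]
      exact ha
  have hB' : (fAct (γ * α) b)⁻¹.toWord ≠ [] := by
    rw [Ne, FreeGroup.toWord_eq_nil_iff, inv_eq_one, map_eq_one_iff _ (MulEquiv.injective _)]
    exact hb
  apply hd
  refine finish hI α γ a b 1 d h ?_
  simp only [map_one, inv_one, FreeGroup.toWord_one, List.append_nil]
  have R : ∀ x : FreeGroup X, FreeGroup.IsReduced x.toWord := fun x => FreeGroup.isReduced_toWord
  refine ⟨red_app (red_app (red_app (R _) (R _) J1) (R _) (J_left hB J2)) (R _) (J_left hA' J3), ?_⟩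
  exact J_left hB' (by simp only [List.append_assoc]; exact (J_right hA J4))

theorem claim_all (hI : Iso2 P X) (n : ℕ) : Claim P X n := by
  induction n with
  | zero => intro α γ a b c d hc h; omega
  | succ n H =>
    intro α γ a b c d hc hn h
    by_contra hd
    have hn : a.norm + b.norm + c.norm ≤ n := by omega
    have step : ∀ {α γ : P} {a b c d : FreeGroup X}, Commute α γ → wk α γ a b c = d ^ 2 →
        d ≠ 1 → wk (γ * α) α⁻¹ b c (fAct α a)⁻¹ = (a⁻¹ * d * (a⁻¹)⁻¹) ^ 2 ∧
         (a⁻¹ * d * (a⁻¹)⁻¹) ≠ 1 := by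
      intro α γ a b c d hc h hd
      refine ⟨by rw [wk_rot hc, h, conj_sq], by rwa [Ne, conj_one]⟩
    obtain ⟨h1, hd1⟩ := step hc h hd
    have hc1 := rot_comm hc
    have e1 : α⁻¹ * (γ * α) = γ := by rw [← hc.eq]; group
    obtain ⟨h2, hd2⟩ := step hc1 h1 hd1
    have hc2 := rot_comm hc1
    rw [e1] at h2 hc2
    obtain ⟨h3, hd3⟩ := step hc2 h2 hd2
    have hc3 := rot_comm hc2
    have e2 : (γ * α)⁻¹ * γ = α⁻¹ := by rw [← hc.eq, mul_inv_rev, (hc.inv_inv).eq.symm]; group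
    rw [e2] at h3 hc3
    obtain ⟨h4, hd4⟩ := step hc3 h3 hd3
    have hc4 := rot_comm hc3
    have e3 : γ⁻¹ * α⁻¹ = (γ * α)⁻¹ := by rw [← hc.eq]; group
    rw [e3] at h4 hc4
    obtain ⟨h5, hd5⟩ := step hc4 h4 hd4
    have hc5 := rot_comm hc4
    have e5 : α⁻¹⁻¹ * (γ * α)⁻¹ = γ⁻¹ := by group
    rw [e5] at h5 hc5
    have k : ∀ (p : P) (x : FreeGroup X), (fAct p⁻¹ (fAct p x)⁻¹)⁻¹ = x := by
      intro p x; rw [fAct_inv, fAct_inv_self, inv_inv]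
    rw [k] at h4 h5
    rw [k] at h5
    have N : ∀ (p : P) (x : FreeGroup X), (fAct p x)⁻¹.norm = x.norm := by
      intro p x; rw [FreeGroup.norm_inv_eq, norm_fAct]
    have NZ : ∀ (p : P) {x : FreeGroup X}, x ≠ 1 → (fAct p x)⁻¹.toWord ≠ [] := by
      intro p x hx
      rw [Ne, FreeGroup.toWord_eq_nil_iff, inv_eq_one, map_eq_one_iff _ (MulEquiv.injective _)]
      exact hx
    by_cases hc0 : c = 1
    · subst hc0
      exact hd (claim_two hI H hc (by simpa using hn) h)
    by_cases ha0 : a = 1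
    · subst ha0
      rw [map_one, inv_one] at h1
      exact hd1 (claim_two hI H hc1 (by simpa using hn) h1)
    by_cases hb0 : b = 1
    · subst hb0
      rw [map_one, inv_one] at h2
      exact hd2 (claim_two hI H hc2 (by rw [N]; simp at hn; omega) h2)
    have J0 := corner H hc hn h hd
    have J1 := corner H hc1 (by rw [N]; omega) h1 hd1
    have J2 := corner H hc2 (by rw [N, N]; omega) h2 hd2
    have J3 := corner H hc3 (by rw [N, N, N]; omega) h3 hd3
    have J4 := corner H hc4 (by rw [N, N]; omega) h4 hd4
    have J5 := corner H hc5 (by rw [N]; omega) h5 hd5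
    have hA : a.toWord ≠ [] := by simpa using ha0
    have hB : b.toWord ≠ [] := by simpa using hb0
    have hC : c.toWord ≠ [] := by simpa using hc0
    apply hd
    refine finish hI α γ a b c d h ?_
    have R : ∀ x : FreeGroup X, FreeGroup.IsReduced x.toWord := fun x => FreeGroup.isReduced_toWord
    refine ⟨red_app (red_app (red_app (red_app (red_app (R _) (R _) J0) (R _) (J_left hB J1))
      (R _) (J_left hC J2)) (R _) (J_left (NZ _ ha0) J3)) (R _) (J_left (NZ _ hb0) J4), ?_⟩
    exact J_left (NZ _ hc0) (by simp only [List.append_assoc]; exact (J_right hA J5))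

end Act

/-- squares that are commutators are trivial -/
def CS (G : Type*) [Group G] : Prop := ∀ a b c : G, c ^ 2 = a * b * a⁻¹ * b⁻¹ → c = 1

theorem cs_semi {P X : Type*} [Group P] [MulAction P X] (hI : Iso2 P X) (hP : CS P) :
    CS (SemidirectProduct (FreeGroup X) P fAct) := by
  classical
  intro a b c h
  have h' : c * c * b * a = a * b := by rw [← pow_two, h]; group
  have hr : c.right = 1 := by
    apply hP a.right b.right
    have := congrArg SemidirectProduct.right h
    simpa [pow_two] using this
  have h1 := congrArg SemidirectProduct.left h'
  have h2 := congrArg SemidirectProduct.right h'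
  simp only [SemidirectProduct.mul_left, SemidirectProduct.mul_right, hr, one_mul, map_one,
    MulAut.one_apply] at h1 h2
  have hc : Commute b.right a.right := h2
  have hl : c.left = 1 := by
    refine claim_all hI _ b.right (a.right⁻¹ * b.right⁻¹) a.left (fAct a.right b.left) 1 c.left
      ?_ (Nat.lt_succ_self _) ?_
    · exact (hc.inv_right).mul_right (Commute.refl _).inv_right
    · unfold wk
      have : a.right⁻¹ * b.right⁻¹ * b.right = a.right⁻¹ := by group
      rw [this, fAct_inv_self, map_one, pow_two, mul_one, ← h1]
      group
  exact SemidirectProduct.ext hl hr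

section Raag

theorem gen_comm {V : Type*} (Γ : SimpleGraph V) {a b : V} (h : Γ.Adj a b) :
    raagGen Γ a * raagGen Γ b = raagGen Γ b * raagGen Γ a := by
  have : PresentedGroup.mk (raagRels Γ) (FreeGroup.of a * FreeGroup.of b * (FreeGroup.of a)⁻¹ *
    (FreeGroup.of b)⁻¹) = 1 := PresentedGroup.one_of_mem ⟨a, b, h, rfl⟩
  simp only [map_mul, map_inv] at this
  rw [mul_inv_eq_one, mul_inv_eq_iff_eq_mul] at this
  exact this

def rlift {V G : Type*} [Group G] (Γ : SimpleGraph V) (f : V → G)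
    (h : ∀ a b, Γ.Adj a b → f a * f b = f b * f a) : RAAG Γ →* G :=
  PresentedGroup.toGroup (f := f) (by
    rintro r ⟨a, b, hab, rfl⟩
    simp [h a b hab])

theorem rlift_gen {V G : Type*} [Group G] (Γ : SimpleGraph V) (f : V → G)
    (h : ∀ a b, Γ.Adj a b → f a * f b = f b * f a) (a : V) :
    rlift Γ f h (raagGen Γ a) = f a := PresentedGroup.toGroup.of _

variable {V : Type} (Γ : SimpleGraph V) (v : V)

abbrev Gs : SimpleGraph {w : V // w ≠ v} := Γ.comap Subtype.val

abbrev Ls : Subgroup (RAAG (Gs Γ v)) :=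
  Subgroup.closure (raagGen (Gs Γ v) '' {w | Γ.Adj v w.1})

abbrev Xs := RAAG (Gs Γ v) ⧸ Ls Γ v

abbrev SD := SemidirectProduct (FreeGroup (Xs Γ v)) (RAAG (Gs Γ v)) fAct

open Classical in
noncomputable def toSgen (w : V) : SD Γ v :=
  if h : w = v then SemidirectProduct.inl (FreeGroup.of ((1 : RAAG (Gs Γ v)) : Xs Γ v))
  else SemidirectProduct.inr (raagGen (Gs Γ v) ⟨w, h⟩)

theorem toSgen_self : toSgen Γ v v =
  SemidirectProduct.inl (FreeGroup.of ((1 : RAAG (Gs Γ v)) : Xs Γ v)) := by simp [toSgen]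

theorem toSgen_ne (w : V) (h : w ≠ v) : toSgen Γ v w =
  SemidirectProduct.inr (raagGen (Gs Γ v) ⟨w, h⟩) := by simp [toSgen, h]

theorem toSgen_comm_v (w : V) (h : Γ.Adj v w) :
    toSgen Γ v v * toSgen Γ v w = toSgen Γ v w * toSgen Γ v v := by
  have hw : w ≠ v := h.ne'
  rw [toSgen_self, toSgen_ne Γ v w hw]
  have : raagGen (Gs Γ v) ⟨w, hw⟩ • ((1 : RAAG (Gs Γ v)) : Xs Γ v) = ((1 : RAAG (Gs Γ v)) : Xs Γ v) := by
    rw [MulAction.Quotient.smul_coe, smul_eq_mul, mul_one]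
    symm
    rw [QuotientGroup.eq, inv_one, one_mul]
    exact Subgroup.subset_closure ⟨_, h, rfl⟩
  refine SemidirectProduct.ext ?_ ?_
  · simp [fAct_of, this]
  · simp

noncomputable def toS : RAAG Γ →* SD Γ v := rlift Γ (toSgen Γ v) (by
  intro a b hab
  by_cases ha : a = v
  · subst ha; exact toSgen_comm_v Γ _ b hab
  by_cases hb : b = v
  · subst hb; exact (toSgen_comm_v Γ _ a hab.symm).symm
  rw [toSgen_ne Γ v a ha, toSgen_ne Γ v b hb, ← map_mul, ← map_mul, gen_comm]
  exact hab)

noncomputable def inc : RAAG (Gs Γ v) →* RAAG Γ := rlift _ (fun w => raagGen Γ w.1) (by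
  intro a b hab
  exact gen_comm Γ hab)

theorem inc_gen (w) : inc Γ v (raagGen _ w) = raagGen Γ w.1 := rlift_gen _ _ _ _

theorem inc_L (l : RAAG (Gs Γ v)) (hl : l ∈ Ls Γ v) : Commute (inc Γ v l) (raagGen Γ v) := by
  have : Ls Γ v ≤ (Subgroup.centralizer {raagGen Γ v}).comap (inc Γ v) := by
    rw [Subgroup.closure_le]
    rintro _ ⟨w, hw, rfl⟩
    simp only [Subgroup.coe_comap, Set.mem_preimage, SetLike.mem_coe, inc_gen,
      Subgroup.mem_centralizer_singleton_iff]
    exact (gen_comm Γ hw).symm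
  have h2 := this hl
  rw [Subgroup.mem_comap, Subgroup.mem_centralizer_singleton_iff] at h2
  exact h2

noncomputable def cj : Xs Γ v → RAAG Γ := fun x => Quotient.liftOn' x
  (fun g => inc Γ v g * raagGen Γ v * (inc Γ v g)⁻¹) (by
    intro g g' h
    rw [QuotientGroup.leftRel_apply] at h
    have hc := (inc_L Γ v _ h).eq
    have e : inc Γ v g' = inc Γ v g * inc Γ v (g⁻¹ * g') := by rw [← map_mul]; group
    change inc Γ v g * raagGen Γ v * (inc Γ v g)⁻¹ = inc Γ v g' * raagGen Γ v * (inc Γ v g')⁻¹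
    rw [e, mul_assoc (inc Γ v g) (inc Γ v (g⁻¹ * g')), hc]
    group)

theorem cj_mk (g : RAAG (Gs Γ v)) : cj Γ v (g : Xs Γ v) =
    inc Γ v g * raagGen Γ v * (inc Γ v g)⁻¹ := rfl

noncomputable def back : SD Γ v →* RAAG Γ :=
  SemidirectProduct.lift (FreeGroup.lift (cj Γ v)) (inc Γ v) (by
    intro g
    refine FreeGroup.ext_hom _ _ ?_
    intro x
    induction x using QuotientGroup.induction_on with
    | H x =>
      simp [fAct_of, cj_mk, MulAction.Quotient.smul_coe, mul_assoc])

theorem back_toS (g : RAAG Γ) : back Γ v (toS Γ v g) = g := by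
  have : (back Γ v).comp (toS Γ v) = MonoidHom.id _ := by
    refine PresentedGroup.ext ?_
    intro w
    change back Γ v (toS Γ v (raagGen Γ w)) = raagGen Γ w
    rw [toS, rlift_gen]
    by_cases h : w = v
    · subst h
      rw [toSgen_self, back, SemidirectProduct.lift_inl, FreeGroup.lift_apply_of, cj_mk]
      simp
    · rw [toSgen_ne Γ v w h, back, SemidirectProduct.lift_inr, inc_gen]
  exact DFunLike.congr_fun this g

/-- square-isolation of parabolic subgroups -/
def IsoPar : Prop := ∀ (S : Set V) (g : RAAG Γ), g ^ 2 ∈ Subgroup.closure (raagGen Γ '' S) →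
  g ∈ Subgroup.closure (raagGen Γ '' S)

theorem iso2_Xs (h : IsoPar (Gs Γ v)) : Iso2 (RAAG (Gs Γ v)) (Xs Γ v) := by
  intro p x
  induction x using QuotientGroup.induction_on with
  | H g =>
    intro hx
    rw [MulAction.Quotient.smul_coe, MulAction.Quotient.smul_coe, eq_comm, QuotientGroup.eq] at hx
    rw [MulAction.Quotient.smul_coe, eq_comm, QuotientGroup.eq]
    apply h
    convert hx using 1
    simp only [smul_eq_mul, pow_two]
    group

theorem main_ind (n : ℕ) : ∀ (V : Type) [Fintype V] (Γ : SimpleGraph V), Fintype.card V < n →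
    CS (RAAG Γ) ∧ IsoPar Γ := by
  classical
  induction n with
  | zero => intro V _ Γ h; omega
  | succ n ih =>
    intro V _ Γ hn
    have key : ∀ v : V, CS (RAAG (Gs Γ v)) ∧ IsoPar (Gs Γ v) := by
      intro v
      apply ih
      have := Fintype.card_subtype_lt (p := fun w => w ≠ v) (x := v) (by simp)
      omega
    constructor
    · by_cases hV : Nonempty V
      · obtain ⟨v⟩ := hV
        intro a b c h
        have := cs_semi (iso2_Xs Γ v (key v).2) (key v).1 (toS Γ v a) (toS Γ v b) (toS Γ v c)
          (by simp only [← map_mul, ← map_inv, ← map_pow, h])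
        rw [← back_toS Γ v c, this, map_one]
      · intro a b c _
        have := PresentedGroup.generated_by (raagRels Γ) ⊥ (fun j => (hV ⟨j⟩).elim) c
        simpa using this
    · intro S g hg
      by_cases hS : ∃ v, v ∉ S
      · obtain ⟨v, hv⟩ := hS
        set S' : Set {w : V // w ≠ v} := {w | w.1 ∈ S} with hS'
        have h1 : Subgroup.closure (raagGen Γ '' S) ≤
            ((Subgroup.closure (raagGen (Gs Γ v) '' S')).map SemidirectProduct.inr).comap (toS Γ v) := by
          rw [Subgroup.closure_le]
          rintro _ ⟨w, hw, rfl⟩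
          have hwv : w ≠ v := fun e => hv (e ▸ hw)
          refine ⟨raagGen (Gs Γ v) ⟨w, hwv⟩, Subgroup.subset_closure ⟨_, hw, rfl⟩, ?_⟩
          rw [toS, rlift_gen, toSgen_ne Γ v w hwv]
        have h2 : Subgroup.closure (raagGen (Gs Γ v) '' S') ≤
            (Subgroup.closure (raagGen Γ '' S)).comap (inc Γ v) := by
          rw [Subgroup.closure_le]
          rintro _ ⟨w, hw, rfl⟩
          change inc Γ v (raagGen (Gs Γ v) w) ∈ Subgroup.closure (raagGen Γ '' S)
          rw [inc_gen]
          exact Subgroup.subset_closure ⟨_, hw, rfl⟩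
        obtain ⟨l, hl, e⟩ := h1 hg
        rw [map_pow] at e
        set k := toS Γ v g with hk
        have er := congrArg SemidirectProduct.right e
        have el := congrArg SemidirectProduct.left e
        simp only [pow_two, SemidirectProduct.mul_left, SemidirectProduct.mul_right,
          SemidirectProduct.left_inr, SemidirectProduct.right_inr] at er el
        have hr : k.right ∈ Subgroup.closure (raagGen (Gs Γ v) '' S') := by
          apply (key v).2
          rw [pow_two, ← er]; exact hl
        have hl1 : k.left = 1 := one_of_inv (iso2_Xs Γ v (key v).2) k.right _
          (eq_inv_of_mul_eq_one_right el.symm)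
        have hkr : k = SemidirectProduct.inr k.right := SemidirectProduct.ext hl1 rfl
        have : g = inc Γ v k.right := by
          rw [← back_toS Γ v g, ← hk]
          nth_rewrite 1 [hkr]
          rw [back, SemidirectProduct.lift_inr]
        rw [this]
        exact h2 hr
      · push Not at hS
        exact PresentedGroup.generated_by (raagRels Γ) (Subgroup.closure (raagGen Γ '' S))
          (fun j => Subgroup.subset_closure ⟨j, hS j, rfl⟩) g

end Raag
end RaagV

/-- Vaught's conjecture for RAAGs: if `x² y² z² = 1` in a RAAG, then `x`, `y`, `z`
pairwise commute. -/
theorem raag_vaught_conjecture {A : Type} [Fintype A] (Γ : SimpleGraph A)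
    (x y z : RAAG Γ) (h : x ^ 2 * y ^ 2 * z ^ 2 = 1) :
    x * y = y * x ∧ y * z = z * y ∧ x * z = z * x := by
  have hcs := (RaagV.main_ind _ A Γ (Nat.lt_succ_self _)).1
  have id1 : x ^ 2 * y ^ 2 * z ^ 2 =
      x * ((x * y) * (y * z) * (x * y)⁻¹ * (y * z)⁻¹) * x⁻¹ * (x * y * z) ^ 2 := by
    simp only [pow_two]; group
  rw [h] at id1
  have hc : (x⁻¹ * (x * y * z)⁻¹ * x) = 1 := by
    apply hcs (x * y) (y * z)
    have e : (x⁻¹ * (x * y * z)⁻¹ * x) ^ 2 = x⁻¹ * ((x * y * z) ^ 2)⁻¹ * x := by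
      simp only [pow_two]; group
    rw [e, inv_eq_of_mul_eq_one_left id1.symm]
    group
  have h1 : x * y * z = 1 := by
    have : x * y * z = x * (x⁻¹ * (x * y * z)⁻¹ * x)⁻¹ * x⁻¹ := by group
    rw [this, hc]; group
  have hz : z = (x * y)⁻¹ := (inv_eq_of_mul_eq_one_right h1).symm
  have hyz : y * z = x⁻¹ := by rw [hz]; group
  rw [h1, hyz, one_pow, mul_one] at id1
  have h3 : x * y * x⁻¹ * (x * y)⁻¹ * x = 1 := by
    have : x * y * x⁻¹ * (x * y)⁻¹ * x = x⁻¹ * (x * (x * y * x⁻¹ * (x * y)⁻¹ * x⁻¹⁻¹) * x⁻¹) * x := by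
      group
    rw [this, ← id1]; group
  have hxy : x * y = y * x := by
    have h5 : y * x⁻¹ * y⁻¹ * x = 1 := by
      have : y * x⁻¹ * y⁻¹ * x = x⁻¹ * (x * y * x⁻¹ * (x * y)⁻¹ * x) * x := by group
      rw [this, h3]; group
    have h6 : y * x⁻¹ * y⁻¹ = x⁻¹ := eq_inv_of_mul_eq_one_left h5
    have h7 : Commute y x⁻¹ := mul_inv_eq_iff_eq_mul.1 h6
    exact (Commute.inv_right_iff.1 h7).eq.symm
  have c1 : Commute x y := hxy
  refine ⟨hxy, ?_, ?_⟩
  · rw [hz]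
    exact (c1.symm.mul_right (Commute.refl y)).inv_right.eq
  · rw [hz]
    exact ((Commute.refl x).mul_right c1).inv_right.eq
end
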